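/- arXiv:math/0506466 — 2 statements merged into one kernel-verified Lean document; each statement's English description precedes it below -/
import Mathlib

section
/- (Lawrence–Varchenko Formula) Let P ⊂ ℝ^d be a simple full-dimensional polytope with rational vertices, and let ξ ∈ ℝ^d satisfy ξ·w ≠ 0 for every edge direction w of P. For each vertex v, let E^+_v(ξ) and E^−_v(ξ) be the edge directions w at v with w·ξ > 0 and w·ξ < 0 respectively, and let K_{ξ,v} := v + Σ_{w∈E^+_v(ξ)} ℝ_{≥0}w + Σ_{w∈E^−_v(ξ)} ℝ_{<0}w. Then in ℂ(x_1,…,x_d): σ_P(x) = Σ_{v vertex of P} (−1)^{|E^−_v(ξ)|} φ(S_{K_{ξ,v}}), where σ_P(x) = Σ_{m ∈ P∩ℤ^d} x^m. -/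
open scoped BigOperators Classical

noncomputable section

/-- The real vector corresponding to an integer vector. -/
def toR (d : ℕ) (m : Fin d → ℤ) : Fin d → ℝ := fun i => (m i : ℝ)

/-- The standard dot product on `ℝ^d`. -/
def dotR (d : ℕ) (x y : Fin d → ℝ) : ℝ := ∑ i, x i * y i

/-- Laurent polynomials `ℂ[x₁^{±1},…,x_d^{±1}]`, represented by their coefficient functions. -/
abbrev LaurentPoly (d : ℕ) := (Fin d → ℤ) →₀ ℂ

/-- The integer-point generating series of a subset of `ℝ^d`: the function `ℤ^d → ℂ`
equal to `1` on `S ∩ ℤ^d` and `0` elsewhere. -/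
def genSeries (d : ℕ) (S : Set (Fin d → ℝ)) : (Fin d → ℤ) → ℂ :=
  fun m => if toR d m ∈ S then 1 else 0

/-- The action of a Laurent polynomial on a formal Laurent series,
`(x^w · S)(m) = S(m - w)` extended linearly. -/
def actLP (d : ℕ) (g : LaurentPoly d) (S : (Fin d → ℤ) → ℂ) : (Fin d → ℤ) → ℂ :=
  fun m => ∑ w ∈ g.support, g w * S (m - w)

/-- The series of a Laurent polynomial `f`, i.e. `Σ_m f_m x^m` as a formal series. -/
def seriesOf (d : ℕ) (f : LaurentPoly d) : (Fin d → ℤ) → ℂ := fun m => f m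

/-- The cone `v + ℝ_{≥0} w₁ + ⋯ + ℝ_{≥0} w_n`. -/
def coneSet (d n : ℕ) (v : Fin d → ℝ) (w : Fin n → Fin d → ℤ) : Set (Fin d → ℝ) :=
  {y | ∃ lam : Fin n → ℝ, (∀ i, 0 ≤ lam i) ∧ y = v + ∑ i, lam i • toR d (w i)}

/-- The fundamental half-open parallelepiped `{v + Σ λᵢ wᵢ : 0 ≤ λᵢ < 1}`. -/
def parSet (d : ℕ) (v : Fin d → ℝ) (w : Fin d → Fin d → ℤ) : Set (Fin d → ℝ) :=
  {y | ∃ lam : Fin d → ℝ, (∀ i, 0 ≤ lam i ∧ lam i < 1) ∧ y = v + ∑ i, lam i • toR d (w i)}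

/-- A simple rational cone: `v + ℝ_{≥0} w₁ + ⋯ + ℝ_{≥0} w_d` with `w₁,…,w_d ∈ ℤ^d`
linearly independent. -/
def IsSimpleCone (d : ℕ) (K : Set (Fin d → ℝ)) : Prop :=
  ∃ (v : Fin d → ℝ) (w : Fin d → Fin d → ℤ),
    LinearIndependent ℝ (fun i => toR d (w i)) ∧ K = coneSet d d v w

/-- Membership in the module `PL` of polyhedral Laurent series: a finite
`ℂ[x₁^{±1},…,x_d^{±1}]`-linear combination of the series of simple rational cones. -/
def MemPL (d : ℕ) (S : (Fin d → ℤ) → ℂ) : Prop :=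
  ∃ (n : ℕ) (g : Fin n → LaurentPoly d) (K : Fin n → Set (Fin d → ℝ)),
    (∀ i, IsSimpleCone d (K i)) ∧ S = ∑ i, actLP d (g i) (genSeries d (K i))

/-- The field of rational functions `ℂ(x₁,…,x_d)`. -/
abbrev RatF (d : ℕ) := FractionRing (MvPolynomial (Fin d) ℂ)

/-- The monomial `x^w`, `w ∈ ℤ^d`, as a rational function. -/
def ratMon (d : ℕ) (w : Fin d → ℤ) : RatF d :=
  ∏ i, (algebraMap (MvPolynomial (Fin d) ℂ) (RatF d) (MvPolynomial.X i)) ^ (w i)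

/-- A Laurent polynomial as a rational function. -/
def toRat (d : ℕ) (g : LaurentPoly d) : RatF d :=
  ∑ w ∈ g.support, algebraMap (MvPolynomial (Fin d) ℂ) (RatF d) (MvPolynomial.C (g w)) * ratMon d w

/-- `σ_S(x) = Σ_{m ∈ S ∩ ℤ^d} x^m`, as a rational function (for `S` with finitely many
integer points). -/
def sigmaSet (d : ℕ) (S : Set (Fin d → ℝ)) : RatF d :=
  ∑ᶠ m ∈ {m : Fin d → ℤ | toR d m ∈ S}, ratMon d m

/-- `φ : PL → ℂ(x₁,…,x_d)` is the `ℂ[x₁^{±1},…,x_d^{±1}]`-module homomorphism sending the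
series `S_K` of a simple rational cone `K` to `σ_{P_K}(x) / Π (1 - x^{wᵢ})`. -/
def IsPhi (d : ℕ) (φ : ((Fin d → ℤ) → ℂ) → RatF d) : Prop :=
  (∀ S T, MemPL d S → MemPL d T → φ (S + T) = φ S + φ T) ∧
  (∀ (g : LaurentPoly d) (S), MemPL d S → φ (actLP d g S) = toRat d g * φ S) ∧
  (∀ (v : Fin d → ℝ) (w : Fin d → Fin d → ℤ),
      LinearIndependent ℝ (fun i => toR d (w i)) →
      φ (genSeries d (coneSet d d v w)) =
        sigmaSet d (parSet d v w) / ∏ i, (1 - ratMon d (w i)))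

/-- A convex polyhedron: an intersection of finitely many closed halfspaces. -/
def IsPolyhedron (d : ℕ) (P : Set (Fin d → ℝ)) : Prop :=
  ∃ (n : ℕ) (a : Fin n → Fin d → ℝ) (b : Fin n → ℝ),
    P = {y | ∀ i, dotR d (a i) y ≤ b i}

/-- The polar `P^∨ = {x : ⟨x,y⟩ ≤ 1 for all y ∈ P}`. -/
def polar (d : ℕ) (P : Set (Fin d → ℝ)) : Set (Fin d → ℝ) :=
  {x | ∀ y ∈ P, dotR d x y ≤ 1}


/-- The half-open cone `K_{ξ,v} = v + Σ_{w·ξ>0} ℝ_{≥0} w + Σ_{w·ξ<0} ℝ_{<0} w`. -/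
def lvCone (d : ℕ) (v : Fin d → ℝ) (w : Fin d → Fin d → ℤ) (xi : Fin d → ℝ) :
    Set (Fin d → ℝ) :=
  {y | ∃ lam : Fin d → ℝ,
    (∀ i, (0 < dotR d xi (toR d (w i)) → 0 ≤ lam i) ∧
          (dotR d xi (toR d (w i)) < 0 → lam i < 0)) ∧
    y = v + ∑ i, lam i • toR d (w i)}

/-- The vertices `v k` of a polytope `P`, each with a basis `b k` of edge directions spanning
the tangent cone of `P` at `v k`. -/
structure IsSimpleVertexSystem {E ι κ : Type*} [NormedAddCommGroup E] [NormedSpace ℝ E]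
    (P : Set E) (v : κ → E) (b : κ → Module.Basis ι ℝ E) : Prop where
  injective : Function.Injective v
  eq_hull : P = convexHull ℝ (Set.range v)
  range_eq : Set.range v = P.extremePoints ℝ
  coord_nonneg : ∀ k, ∀ y ∈ P, ∀ i, 0 ≤ (b k).repr (y - v k) i
  exists_mem : ∀ k i, ∃ t : ℝ, 0 < t ∧ v k + t • b k i ∈ P

/-- The pairs `p = (vertex, direction)` and `q` describe the same edge from its two ends. -/
def IsOppositeEnd {E ι κ : Type*} [NormedAddCommGroup E] [NormedSpace ℝ E]
    (v : κ → E) (b : κ → Module.Basis ι ℝ E) (p q : κ × ι) : Prop :=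
  (∃ t : ℝ, 0 < t ∧ v q.1 = v p.1 + t • b p.1 p.2) ∧
    ∃ c : ℝ, 0 < c ∧ b q.1 q.2 = -(c • b p.1 p.2)

section Edges

variable {E ι κ : Type*} [NormedAddCommGroup E] [NormedSpace ℝ E] {P : Set E} {v : κ → E}
  {b : κ → Module.Basis ι ℝ E}

theorem IsOppositeEnd.symm {p q : κ × ι} (h : IsOppositeEnd v b p q) :
    IsOppositeEnd v b q p := by
  obtain ⟨⟨t, ht, hv⟩, c, hc, hb⟩ := h
  refine ⟨⟨t / c, by positivity, ?_⟩, c⁻¹, by positivity, ?_⟩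
  · rw [hv, hb, smul_neg, smul_smul, div_mul_cancel₀ _ hc.ne']
    abel
  · rw [hb, smul_neg, smul_smul, inv_mul_cancel₀ hc.ne', one_smul, neg_neg]

theorem IsSimpleVertexSystem.mem (h : IsSimpleVertexSystem P v b) (k : κ) : v k ∈ P := by
  rw [h.eq_hull]
  exact subset_convexHull ℝ _ ⟨k, rfl⟩

theorem IsSimpleVertexSystem.convex (h : IsSimpleVertexSystem P v b) : Convex ℝ P := by
  rw [h.eq_hull]
  exact convex_convexHull ℝ _

theorem IsSimpleVertexSystem.vertex_mem_extremePoints (h : IsSimpleVertexSystem P v b) (k : κ) :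
    v k ∈ P.extremePoints ℝ := by
  rw [← h.range_eq]
  exact ⟨k, rfl⟩

theorem IsSimpleVertexSystem.eq_of_mem_ray (h : IsSimpleVertexSystem P v b) {k l l' : κ}
    {w : E} (hw : w ≠ 0) {t t' : ℝ} (ht : 0 < t) (ht' : 0 < t') (hl : v l = v k + t • w)
    (hl' : v l' = v k + t' • w) : l = l' := by
  wlog hle : t ≤ t' generalizing l l' t t'
  · exact (this ht' ht hl' hl (le_of_not_ge hle)).symm
  rcases hle.eq_or_lt with rfl | hlt
  · exact h.injective (hl.trans hl'.symm)
  · exfalso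
    have hseg : v l ∈ openSegment ℝ (v k) (v l') := by
      refine ⟨1 - t / t', t / t', ?_, by positivity, by ring, ?_⟩
      · rw [sub_pos, div_lt_one ht']
        exact hlt
      · rw [hl, hl', smul_add, smul_smul, div_mul_cancel₀ _ ht'.ne', sub_smul, one_smul]
        abel
    have hkl : v k = v l :=
      ((mem_extremePoints.1 (h.vertex_mem_extremePoints l)).2 _ (h.mem k) _ (h.mem l') hseg).1
    rw [hl, left_eq_add] at hkl
    exact (smul_ne_zero ht.ne' hw) hkl

theorem IsOppositeEnd.unique (h : IsSimpleVertexSystem P v b) {p q q' : κ × ι}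
    (hq : IsOppositeEnd v b p q) (hq' : IsOppositeEnd v b p q') : q = q' := by
  obtain ⟨k, i⟩ := p
  obtain ⟨l, j⟩ := q
  obtain ⟨l', j'⟩ := q'
  obtain ⟨⟨t, ht, hv⟩, c, hc, hb⟩ := hq
  obtain ⟨⟨t', ht', hv'⟩, c', hc', hb'⟩ := hq'
  dsimp only at *
  obtain rfl : l = l' := h.eq_of_mem_ray ((b k).ne_zero i) ht ht' hv hv'
  have h1 : c' • b l j = c • b l j' := by
    rw [hb, hb', smul_neg, smul_neg, smul_comm]
  have h2 := congrArg (fun z => (b l).repr z j) h1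
  by_contra hne
  have hjj : j' ≠ j := fun e => hne (by rw [e])
  simp [hjj] at h2
  exact hc'.ne' h2

theorem coord_direction_nonneg (h : IsSimpleVertexSystem P v b) {k l : κ} {j : ι}
    (h0 : (b k).repr (v l - v k) j = 0) (m : ι) : 0 ≤ (b k).repr (b l m) j := by
  obtain ⟨t, ht, hm⟩ := h.exists_mem l m
  have h1 := h.coord_nonneg k _ hm j
  rw [add_sub_right_comm] at h1
  simp only [map_add, map_smul, Finsupp.add_apply, h0, zero_add, Finsupp.smul_apply,
    smul_eq_mul] at h1
  exact nonneg_of_mul_nonneg_right h1 ht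

theorem eq_smul_of_repr_eq_zero [Finite ι] (B : Module.Basis ι ℝ E) {i : ι} {z : E}
    (hz : ∀ j ≠ i, B.repr z j = 0) : z = B.repr z i • B i := by
  apply B.repr.injective
  ext j
  by_cases hj : j = i
  · subst hj
    simp
  · simp [hz j hj, Ne.symm hj]

theorem IsSimpleVertexSystem.exists_isOppositeEnd [Finite ι] [Finite κ]
    (h : IsSimpleVertexSystem P v b) (p : κ × ι) : ∃ q, IsOppositeEnd v b p q := by
  have := Module.Finite.of_basis (b p.1)
  cases nonempty_fintype ι
  obtain ⟨k, i⟩ := p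
  have hcont : ∀ j, Continuous fun y => (b k).repr (y - v k) j := fun j =>
    ((b k).coord j).continuous_of_finiteDimensional.comp (continuous_id.sub continuous_const)
  have hcomp : IsCompact P := by
    rw [h.eq_hull]
    exact (Set.finite_range v).isCompact_convexHull ℝ
  have hrayc : IsCompact (P ∩ {y | ∀ j, j ≠ i → (b k).repr (y - v k) j = 0}) := by
    apply hcomp.inter_right
    simp only [Set.ofPred_forall]
    exact isClosed_iInter fun j => isClosed_iInter fun _ =>
      isClosed_eq (hcont j) continuous_const
  obtain ⟨y, ⟨hyP, hyray⟩, hmax⟩ := hrayc.exists_isMaxOn ⟨v k, h.mem k, by simp⟩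
    (hcont i).continuousOn
  have hmax' : ∀ z ∈ P, (∀ j, j ≠ i → (b k).repr (z - v k) j = 0) →
      (b k).repr (z - v k) i ≤ (b k).repr (y - v k) i := fun z h1 h2 => hmax ⟨h1, h2⟩
  set t := (b k).repr (y - v k) i with ht
  have hy : y = v k + t • b k i := by
    rw [ht, ← eq_smul_of_repr_eq_zero (b k) hyray]
    abel
  have htpos : 0 < t := by
    obtain ⟨s, hs, hsP⟩ := h.exists_mem k i
    have h1 := hmax' _ hsP (fun j hj => by simp [Ne.symm hj])
    simp only [add_sub_cancel_left, map_smul, Module.Basis.repr_self, Finsupp.smul_single,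
      smul_eq_mul, mul_one, Finsupp.single_eq_same] at h1
    linarith
  have hyext : y ∈ P.extremePoints ℝ := by
    refine mem_extremePoints.2 ⟨hyP, ?_⟩
    rintro x₁ h₁ x₂ h₂ ⟨α, β, hα, hβ, hαβ, hxy⟩
    have hcomb : ∀ j, α * (b k).repr (x₁ - v k) j + β * (b k).repr (x₂ - v k) j
        = (b k).repr (y - v k) j := by
      intro j
      have : y - v k = α • (x₁ - v k) + β • (x₂ - v k) := by
        rw [← hxy]
        nth_rewrite 1 [← one_smul ℝ (v k)]
        rw [← hαβ]
        module
      rw [this]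
      simp
    have hz : ∀ j, j ≠ i → (b k).repr (x₁ - v k) j = 0 ∧ (b k).repr (x₂ - v k) j = 0 := by
      intro j hj
      have h3 := hcomb j
      rw [hyray j hj] at h3
      have h4 := mul_nonneg hα.le (h.coord_nonneg k _ h₁ j)
      have h5 := mul_nonneg hβ.le (h.coord_nonneg k _ h₂ j)
      constructor
      · exact (mul_eq_zero.1 (by linarith : α * (b k).repr (x₁ - v k) j = 0)).resolve_left hα.ne'
      · exact (mul_eq_zero.1 (by linarith : β * (b k).repr (x₂ - v k) j = 0)).resolve_left hβ.ne'
    have h6 := hmax' _ h₁ fun j hj => (hz j hj).1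
    have h7 := hmax' _ h₂ fun j hj => (hz j hj).2
    have h8 := hcomb i
    rw [← ht] at h8
    have h9 : (b k).repr (x₁ - v k) i = t := by nlinarith
    have h10 : (b k).repr (x₂ - v k) i = t := by nlinarith
    constructor
    · have := eq_smul_of_repr_eq_zero (b k) fun j hj => (hz j hj).1
      rw [h9] at this
      rw [hy, ← this]
      abel
    · have := eq_smul_of_repr_eq_zero (b k) fun j hj => (hz j hj).2
      rw [h10] at this
      rw [hy, ← this]
      abel
  rw [← h.range_eq] at hyext
  obtain ⟨l, rfl⟩ := hyext
  have hdir := fun j (hj : j ≠ i) => coord_direction_nonneg h (hyray j hj)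
  have hlam : ∀ m, 0 ≤ (b l).repr (v k - v l) m := h.coord_nonneg l _ (h.mem k)
  have hsum : ∑ m, (b l).repr (v k - v l) m • b l m = v k - v l := (b l).sum_repr _
  have hzero : ∀ m, (b l).repr (v k - v l) m ≠ 0 → ∀ j, j ≠ i → (b k).repr (b l m) j = 0 := by
    intro m hm j hj
    have h1 : ∑ m, (b l).repr (v k - v l) m * (b k).repr (b l m) j = 0 := by
      have h2 := congrArg (fun z => (b k).repr z j) hsum
      simp only [map_sum, map_smul, Finsupp.coe_finsetSum, Finset.sum_apply, Finsupp.smul_apply,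
        smul_eq_mul] at h2
      rw [h2, ← neg_sub, map_neg, Finsupp.neg_apply, hyray j hj, neg_zero]
    rw [Finset.sum_eq_zero_iff_of_nonneg
      fun m _ => mul_nonneg (hlam m) (hdir j hj m)] at h1
    exact (mul_eq_zero.1 (h1 m (Finset.mem_univ _))).resolve_left hm
  obtain ⟨m, hm⟩ : ∃ m, (b l).repr (v k - v l) m ≠ 0 := by
    by_contra! hall
    rw [Finset.sum_eq_zero fun m _ => by rw [hall m, zero_smul]] at hsum
    rw [ht, ← neg_sub, ← hsum] at htpos
    simp at htpos
  have hpar := eq_smul_of_repr_eq_zero (b k) (hzero m hm)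
  set α := (b k).repr (b l m) i with hα
  have hαneg : α < 0 := by
    have hαne : α ≠ 0 := by
      intro h0
      rw [h0, zero_smul] at hpar
      exact (b l).ne_zero m hpar
    refine lt_of_le_of_ne ?_ hαne
    obtain ⟨s, hs, hsP⟩ := h.exists_mem l m
    have h1 : v l + s • b l m - v k = (t + s * α) • b k i := by
      rw [hpar]
      nth_rewrite 1 [hy]
      module
    have h2 := hmax' _ hsP (fun j hj => by rw [h1]; simp [Ne.symm hj])
    rw [h1] at h2
    simp only [map_smul, Module.Basis.repr_self, Finsupp.smul_single, smul_eq_mul, mul_one,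
      Finsupp.single_eq_same] at h2
    by_contra! hpos
    have := mul_pos hs hpos
    linarith
  refine ⟨(l, m), ⟨t, htpos, hy⟩, -α, neg_pos.2 hαneg, ?_⟩
  rw [neg_smul, neg_neg]
  exact hpar

/-- The remaining edge directions at the two ends of an edge agree up to positive scaling, modulo
the direction of the edge. -/
theorem IsOppositeEnd.exists_perm [Finite ι] (h : IsSimpleVertexSystem P v b) {p q : κ × ι}
    (hpq : IsOppositeEnd v b p q) : ∃ π : Equiv.Perm ι, π p.2 = q.2 ∧ ∀ j, j ≠ p.2 →
      ∃ c : ℝ, 0 < c ∧ (∃ μ : ℝ, b q.1 (π j) = c • b p.1 j + μ • b p.1 p.2) ∧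
        ∀ z, (b p.1).repr z j = c * (b q.1).repr z (π j) := by
  cases nonempty_fintype ι
  have hqp := hpq.symm
  obtain ⟨k, i⟩ := p
  obtain ⟨l, i'⟩ := q
  obtain ⟨⟨t, ht, hv⟩, c, hc, hb⟩ := hpq
  obtain ⟨⟨t', ht', hv'⟩, c', hc', hb'⟩ := hqp
  dsimp only at *
  have hN : ∀ j, j ≠ i → ∀ m, 0 ≤ (b k).repr (b l m) j := fun j hj =>
    coord_direction_nonneg h (by rw [hv]; simp [Ne.symm hj])
  have hN' : ∀ j, j ≠ i' → ∀ m, 0 ≤ (b l).repr (b k m) j := fun j hj =>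
    coord_direction_nonneg h (by rw [hv']; simp [Ne.symm hj])
  have hNi : ∀ j, j ≠ i → (b k).repr (b l i') j = 0 := fun j hj => by
    rw [hb]; simp [Ne.symm hj]
  have hexp : ∀ z j, (b k).repr z j = ∑ m, (b l).repr z m * (b k).repr (b l m) j := by
    intro z j
    conv_lhs => rw [← (b l).sum_repr z]
    simp only [map_sum, map_smul, Finsupp.coe_finsetSum, Finset.sum_apply, Finsupp.smul_apply,
        smul_eq_mul]
  have hterm : ∀ j, j ≠ i → ∀ a m, 0 ≤ (b l).repr (b k a) m * (b k).repr (b l m) j := by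
    intro j hj a m
    by_cases hm : m = i'
    · rw [hm, hNi j hj, mul_zero]
    · exact mul_nonneg (hN' m hm a) (hN j hj m)
  have hex : ∀ j, ∃ m, j ≠ i → 0 < (b l).repr (b k j) m * (b k).repr (b l m) j := by
    intro j
    by_cases hj : j = i
    · exact ⟨i, fun h => absurd hj h⟩
    · by_contra! hall
      have h1 := hexp (b k j) j
      rw [Finset.sum_eq_zero fun m _ => le_antisymm (hall m).2 (hterm j hj j m)] at h1
      simp at h1
  choose f hf using hex
  let g : ι → ι := fun j => if j = i then i' else f j
  have hgi : g i = i' := if_pos rfl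
  have hgj : ∀ j, j ≠ i → g j = f j := fun j hj => if_neg hj
  have hne : ∀ j, j ≠ i → f j ≠ i' := by
    intro j hj h1
    have := hf j hj
    rw [h1, hNi j hj, mul_zero] at this
    exact this.false
  have hpos : ∀ j, j ≠ i → 0 < (b k).repr (b l (f j)) j := fun j hj =>
    lt_of_le_of_ne (hN j hj _) fun h0 => by
      have := hf j hj
      rw [← h0, mul_zero] at this
      exact this.false
  have hoff : ∀ j, j ≠ i → ∀ a, a ≠ i → a ≠ j → (b k).repr (b l (f j)) a = 0 := by
    intro j hj a ha haj
    have h1 := hexp (b k j) a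
    rw [Module.Basis.repr_self, Finsupp.single_apply, if_neg haj.symm, eq_comm,
      Finset.sum_eq_zero_iff_of_nonneg fun m _ => hterm a ha j m] at h1
    refine (mul_eq_zero.1 (h1 (f j) (Finset.mem_univ _))).resolve_left fun h0 => ?_
    have := hf j hj
    rw [h0, zero_mul] at this
    exact this.false
  have hginj : Function.Injective g := by
    intro a a' haa
    by_cases ha : a = i
    · by_cases ha' : a' = i
      · rw [ha, ha']
      · rw [ha, hgi, hgj a' ha'] at haa
        exact absurd haa.symm (hne a' ha')
    · by_cases ha' : a' = i
      · rw [ha', hgi, hgj a ha] at haa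
        exact absurd haa (hne a ha)
      · by_contra hne'
        rw [hgj a ha, hgj a' ha'] at haa
        have h1 := hoff a' ha' a ha hne'
        rw [← haa] at h1
        exact (hpos a ha).ne' h1
  refine ⟨Equiv.ofBijective g (Finite.injective_iff_bijective.1 hginj), hgi, fun j hj =>
    ⟨(b k).repr (b l (f j)) j, hpos j hj, ⟨(b k).repr (b l (f j)) i, ?_⟩, fun z => ?_⟩⟩
  · rw [Equiv.ofBijective_apply, hgj j hj]
    apply (b k).repr.injective
    ext a
    by_cases ha : a = i
    · subst ha
      simp [hj]
    · by_cases haj : a = j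
      · subst haj
        simp [Ne.symm ha]
      · simp [Ne.symm ha, Ne.symm haj, hoff j hj a ha haj]
  · rw [hexp z j, Equiv.ofBijective_apply, hgj j hj, Finset.sum_eq_single (f j), mul_comm]
    · intro m _ hm
      obtain ⟨a, rfl⟩ := (Finite.injective_iff_surjective.1 hginj) m
      by_cases ha : a = i
      · rw [ha, hgi, hNi j hj, mul_zero]
      · rw [hgj a ha] at hm ⊢
        rw [hoff a ha j hj (fun e => hm (by rw [e])), mul_zero]
    · simp

end Edges

section VertexSum

/-- The difference between the indicator of `0 ≤ lam` and the indicator of `x < 0`, where `x = 0`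
is counted as half negative. -/
def halfWeight (lam x : ℝ) : ℂ :=
  (if 0 ≤ lam then 1 else 0) - (if x < 0 then 1 else if x = 0 then 1 / 2 else 0)

theorem halfWeight_mul {c c' : ℝ} (hc : 0 < c) (hc' : 0 < c') (lam x : ℝ) :
    halfWeight (c * lam) (c' * x) = halfWeight lam x := by
  simp [halfWeight, hc, hc', mul_nonneg_iff_of_pos_left, mul_neg_iff, hc'.ne',
    not_lt.2 hc'.le]

theorem halfWeight_congr_right {x x' : ℝ} (h : 0 < x * x') (lam : ℝ) :
    halfWeight lam x = halfWeight lam x' := by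
  rcases pos_and_pos_or_neg_and_neg_of_mul_pos h with ⟨h1, h2⟩ | ⟨h1, h2⟩
  · simp [halfWeight, not_lt.2 h1.le, not_lt.2 h2.le, h1.ne', h2.ne']
  · simp [halfWeight, h1, h2]

theorem halfWeight_sub_add_halfWeight_sub {c : ℝ} (hc : 0 < c) (lam lam' x : ℝ) :
    (halfWeight lam x - halfWeight lam 0) +
      (halfWeight lam' (-(c * x)) - halfWeight lam' 0) = 0 := by
  rcases lt_trichotomy x 0 with h | rfl | h
  · have h1 : 0 < -(c * x) := by nlinarith
    simp only [halfWeight, h, not_lt.2 h1.le, h1.ne', if_true, if_false, lt_irrefl]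
    ring
  · simp
  · have h1 : -(c * x) < 0 := by nlinarith
    simp only [halfWeight, h1, not_lt.2 h.le, h.ne', if_true, if_false, lt_irrefl]
    ring

theorem mul_nonneg_of_halfWeight_ne_zero {lam x : ℝ} (h : halfWeight lam x ≠ 0) :
    0 ≤ lam * x := by
  by_contra! hneg
  apply h
  rcases mul_neg_iff.1 hneg with ⟨h1, h2⟩ | ⟨h1, h2⟩
  · simp [halfWeight, h1.le, h2]
  · simp [halfWeight, not_le.2 h1, not_lt.2 h2.le, h2.ne']

variable {E ι κ : Type*} [NormedAddCommGroup E] [NormedSpace ℝ E] [Fintype ι] [Fintype κ]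
  {P : Set E} {v : κ → E} {b : κ → Module.Basis ι ℝ E}

/-- The signed count of the half-open vertex cones in direction `ξ` containing `y`. -/
def vertexSum (v : κ → E) (b : κ → Module.Basis ι ℝ E) (y : E) (ξ : Module.Dual ℝ E) : ℂ :=
  ∑ k, ∏ i, halfWeight ((b k).repr (y - v k) i) (ξ (b k i))

theorem vertexSum_eq_of_sign_eq (h : IsSimpleVertexSystem P v b) (y : E)
    {ξ₀ ξ₁ : Module.Dual ℝ E} (hone : ∀ k i j, ξ₀ (b k i) = 0 → ξ₀ (b k j) = 0 → i = j)
    (hsame : ∀ k i, ξ₀ (b k i) ≠ 0 → 0 < ξ₁ (b k i) * ξ₀ (b k i)) :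
    vertexSum v b y ξ₁ = vertexSum v b y ξ₀ := by
  set W : Module.Dual ℝ E → κ → ι → ℂ :=
    fun ξ k i => halfWeight ((b k).repr (y - v k) i) (ξ (b k i)) with hW
  have hWeq : ∀ k i, ξ₀ (b k i) ≠ 0 → W ξ₁ k i = W ξ₀ k i := fun k i hki =>
    halfWeight_congr_right (hsame k i hki) _
  let G : κ × ι → ℂ := fun p => if ξ₀ (b p.1 p.2) = 0 then
    (∏ j ∈ Finset.univ.erase p.2, W ξ₀ p.1 j) * (W ξ₁ p.1 p.2 - W ξ₀ p.1 p.2) else 0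
  have hdiff : ∀ k, ∏ i, W ξ₁ k i - ∏ i, W ξ₀ k i = ∑ i, G (k, i) := by
    intro k
    by_cases hk : ∃ i, ξ₀ (b k i) = 0
    · obtain ⟨i, hi⟩ := hk
      rw [Finset.sum_eq_single i]
      · rw [← Finset.mul_prod_erase _ _ (Finset.mem_univ i),
          ← Finset.mul_prod_erase _ (W ξ₀ k) (Finset.mem_univ i),
          Finset.prod_congr rfl fun j hj => hWeq k j fun h0 =>
            Finset.ne_of_mem_erase hj (hone k j i h0 hi)]
        simp only [G, hi, if_true]
        ring
      · intro j _ hj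
        exact if_neg fun h0 => hj (hone k j i h0 hi)
      · simp
    · push Not at hk
      rw [Finset.prod_congr rfl fun j _ => hWeq k j (hk j), sub_self,
        Finset.sum_eq_zero fun j _ => if_neg (hk j)]
  choose σ hσ using h.exists_isOppositeEnd
  have hG : ∑ p, G p = 0 := by
    refine Finset.sum_involution (fun p _ => σ p) ?_ ?_ (fun _ _ => Finset.mem_univ _) ?_
    · intro p _
      obtain ⟨c, hc, hb⟩ := (hσ p).2
      have hξ : ∀ ξ : Module.Dual ℝ E, ξ (b (σ p).1 (σ p).2) = -(c * ξ (b p.1 p.2)) := by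
        intro ξ
        rw [hb, map_neg, map_smul, smul_eq_mul]
      by_cases hp : ξ₀ (b p.1 p.2) = 0
      · have hp' : ξ₀ (b (σ p).1 (σ p).2) = 0 := by rw [hξ, hp, mul_zero, neg_zero]
        simp only [G, hp, hp', if_true]
        obtain ⟨π, hπ, hπj⟩ := (hσ p).exists_perm h
        have hprod : ∏ j ∈ Finset.univ.erase (σ p).2, W ξ₀ (σ p).1 j
            = ∏ j ∈ Finset.univ.erase p.2, W ξ₀ p.1 j := by
          symm
          refine Finset.prod_bij (fun j _ => π j) ?_ (fun _ _ _ _ e => π.injective e) ?_ ?_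
          · intro j hj
            refine Finset.mem_erase.2 ⟨fun e => Finset.ne_of_mem_erase hj ?_, Finset.mem_univ _⟩
            exact π.injective (e.trans hπ.symm)
          · intro j hj
            refine ⟨π.symm j, Finset.mem_erase.2 ⟨fun e => Finset.ne_of_mem_erase hj ?_,
              Finset.mem_univ _⟩, π.apply_symm_apply j⟩
            rw [← hπ, ← e, π.apply_symm_apply]
          · intro j hj
            obtain ⟨a, ha, ⟨μ, hμ⟩, hz⟩ := hπj j (Finset.ne_of_mem_erase hj)
            obtain ⟨⟨t, ht, hv⟩, -⟩ := hσ p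
            have h1 : (b p.1).repr (y - v p.1) j
                = a * (b (σ p).1).repr (y - v (σ p).1) (π j) := by
              rw [← hz, hv]
              simp only [map_sub, map_add, map_smul, Finsupp.sub_apply, Finsupp.add_apply,
                Finsupp.smul_apply, Module.Basis.repr_self]
              rw [Finsupp.single_eq_of_ne (Finset.ne_of_mem_erase hj)]
              simp
            have h2 : ξ₀ (b (σ p).1 (π j)) = a * ξ₀ (b p.1 j) := by
              rw [hμ, map_add, map_smul, map_smul, hp, smul_zero, add_zero, smul_eq_mul]
            simp only [hW]
            rw [h1, h2, ← halfWeight_mul ha one_pos (_ : ℝ) (a * ξ₀ (b p.1 j)), one_mul,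
              ← halfWeight_mul one_pos ha (_ : ℝ) (ξ₀ (b p.1 j)), one_mul]
        rw [hprod, ← mul_add]
        simp only [hW]
        rw [hξ ξ₁, hp, hp', halfWeight_sub_add_halfWeight_sub hc, mul_zero]
      · have hp' : ξ₀ (b (σ p).1 (σ p).2) ≠ 0 := by
          rw [hξ]
          exact neg_ne_zero.2 (mul_ne_zero hc.ne' hp)
        simp only [G, hp, hp', if_false, add_zero]
    · intro p _ _ he
      obtain ⟨⟨t, ht, hv⟩, -⟩ := hσ p
      rw [he, left_eq_add] at hv
      exact smul_ne_zero ht.ne' ((b p.1).ne_zero _) hv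
    · intro p _
      exact (hσ (σ p)).unique h (hσ p).symm
  rw [← sub_eq_zero, vertexSum, vertexSum, ← Finset.sum_sub_distrib]
  rw [Finset.sum_congr rfl fun k _ => hdiff k, ← Fintype.sum_prod_type', hG]

theorem vertexSum_add_smul_eq (h : IsSimpleVertexSystem P v b) (y : E) {ξ η : Module.Dual ℝ E}
    (hone : ∀ k i j, ξ (b k i) * η (b k j) = ξ (b k j) * η (b k i) → i = j) (t : ℝ) :
    vertexSum v b y (ξ + t • η) = vertexSum v b y ξ := by
  have hloc : IsLocallyConstant fun t : ℝ => vertexSum v b y (ξ + t • η) := by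
    rw [IsLocallyConstant.iff_eventually_eq]
    intro t₀
    have hsame : ∀ k i, ∀ᶠ t in nhds t₀, (ξ + t₀ • η) (b k i) ≠ 0 →
        0 < (ξ + t • η) (b k i) * (ξ + t₀ • η) (b k i) := by
      intro k i
      by_cases h0 : (ξ + t₀ • η) (b k i) = 0
      · exact Filter.Eventually.of_forall fun t ht => absurd h0 ht
      · have hc : Continuous fun t : ℝ => (ξ + t • η) (b k i) * (ξ + t₀ • η) (b k i) := by
          simp only [LinearMap.add_apply, LinearMap.smul_apply, smul_eq_mul]
          fun_prop
        filter_upwards [hc.continuousAt.eventually_const_lt (mul_self_pos.2 h0)] with t ht _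
        exact ht
    filter_upwards [Filter.eventually_all.2 fun k => Filter.eventually_all.2 (hsame k)] with t ht
    refine vertexSum_eq_of_sign_eq h y (fun k i j hi hj => hone k i j ?_) ht
    simp only [LinearMap.add_apply, LinearMap.smul_apply, smul_eq_mul] at hi hj
    rw [eq_neg_of_add_eq_zero_left hi, eq_neg_of_add_eq_zero_left hj]
    ring
  simpa using hloc.apply_eq_of_preconnectedSpace t 0

theorem exists_dual_separating (h : IsSimpleVertexSystem P v b) {y : E} (hy : y ∉ P)
    {ξ : Module.Dual ℝ E} (hξ : ∀ k i, ξ (b k i) ≠ 0) : ∃ η : Module.Dual ℝ E,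
      (∀ k, η (y - v k) < 0) ∧
      ∀ k i j, ξ (b k i) * η (b k j) = ξ (b k j) * η (b k i) → i = j := by
  have hclosed : IsClosed P := by
    rw [h.eq_hull]
    exact ((Set.finite_range v).isCompact_convexHull ℝ).isClosed
  obtain ⟨f, u, hfy, hfu⟩ := geometric_hahn_banach_point_closed h.convex hclosed hy
  let u' : {x : κ × ι × ι // x.2.1 ≠ x.2.2} → E := fun x =>
    ξ (b x.1.1 x.1.2.1) • b x.1.1 x.1.2.2 - ξ (b x.1.1 x.1.2.2) • b x.1.1 x.1.2.1
  have hu' : ∀ x, u' x ≠ 0 := by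
    rintro ⟨⟨k, i, j⟩, hij⟩ h0
    have := congrArg (fun z => (b k).repr z i) h0
    simp only [u', map_sub, map_smul, Module.Basis.repr_self, Finsupp.sub_apply,
      Finsupp.smul_apply, Finsupp.single_eq_same, Finsupp.single_eq_of_ne hij] at this
    simp [hξ] at this
  obtain ⟨ζ, hζ⟩ := Module.exists_dual_forall_apply_ne_zero (K := ℝ) u' hu'
  have hsep : ∀ k, ∀ᶠ ε in nhdsWithin (0 : ℝ) {0}ᶜ,
      ((f : Module.Dual ℝ E) + ε • ζ) (y - v k) < 0 := by
    intro k
    apply Filter.Eventually.filter_mono nhdsWithin_le_nhds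
    have hc : Continuous fun ε : ℝ => ((f : Module.Dual ℝ E) + ε • ζ) (y - v k) := by
      simp only [LinearMap.add_apply, LinearMap.smul_apply, smul_eq_mul]
      fun_prop
    apply hc.continuousAt.eventually_lt_const
    have := hfu _ (h.mem k)
    simp only [zero_smul, add_zero, ContinuousLinearMap.coe_coe, map_sub]
    linarith
  have hgen : ∀ x, ∀ᶠ ε in nhdsWithin (0 : ℝ) {0}ᶜ,
      ((f : Module.Dual ℝ E) + ε • ζ) (u' x) ≠ 0 := by
    intro x
    by_cases h0 : f (u' x) = 0
    · filter_upwards [self_mem_nhdsWithin] with ε hε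
      simpa [h0, hζ x] using hε
    · apply Filter.Eventually.filter_mono nhdsWithin_le_nhds
      have hc : Continuous fun ε : ℝ => ((f : Module.Dual ℝ E) + ε • ζ) (u' x) := by
        simp only [LinearMap.add_apply, LinearMap.smul_apply, smul_eq_mul]
        fun_prop
      apply hc.continuousAt.eventually_ne
      simpa using h0
  obtain ⟨ε, h1, h2⟩ :=
    ((Filter.eventually_all.2 hsep).and (Filter.eventually_all.2 hgen)).exists
  refine ⟨(f : Module.Dual ℝ E) + ε • ζ, h1, fun k i j hij => ?_⟩
  by_contra hne
  apply h2 ⟨(k, i, j), hne⟩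
  simp only [u', map_sub, map_smul, smul_eq_mul]
  rw [hij, sub_self]

theorem vertexSum_of_notMem (h : IsSimpleVertexSystem P v b) {y : E} (hy : y ∉ P)
    {ξ : Module.Dual ℝ E} (hξ : ∀ k i, ξ (b k i) ≠ 0) : vertexSum v b y ξ = 0 := by
  obtain ⟨η, hη, hone⟩ := exists_dual_separating h hy hξ
  obtain ⟨t, ht⟩ : ∃ t : ℝ, ∀ k, (ξ + t • η) (y - v k) < 0 := by
    have hk : ∀ k, ∀ᶠ t : ℝ in Filter.atTop, (ξ + t • η) (y - v k) < 0 := by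
      intro k
      filter_upwards [Filter.eventually_gt_atTop (-ξ (y - v k) / η (y - v k))] with t ht
      have := (div_lt_iff_of_neg (hη k)).1 ht
      simp only [LinearMap.add_apply, LinearMap.smul_apply, smul_eq_mul]
      linarith
    exact (Filter.eventually_all.2 hk).exists
  rw [← vertexSum_add_smul_eq h y hone t]
  refine Finset.sum_eq_zero fun k _ => ?_
  by_contra hne
  replace hne := Finset.prod_ne_zero_iff.1 hne
  refine (ht k).not_ge ?_
  rw [← (b k).sum_repr (y - v k), map_sum]
  refine Finset.sum_nonneg fun i hi => ?_
  rw [map_smul, smul_eq_mul]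
  exact mul_nonneg_of_halfWeight_ne_zero (hne i hi)

theorem vertexSum_of_mem (h : IsSimpleVertexSystem P v b) {y : E} (hy : y ∈ P)
    {ξ : Module.Dual ℝ E} (hξ : ∀ k i, ξ (b k i) ≠ 0) : vertexSum v b y ξ = 1 := by
  have hne : Nonempty κ := by
    by_contra hemp
    rw [not_nonempty_iff] at hemp
    rw [h.eq_hull, Set.range_eq_empty] at hy
    simp at hy
  obtain ⟨k₀, hk₀⟩ := Finite.exists_min fun k => ξ (v k)
  have hle : ∀ z ∈ P, ξ (v k₀) ≤ ξ z := by
    intro z hz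
    have hsub : P ⊆ {z | ξ (v k₀) ≤ ξ z} := by
      rw [h.eq_hull]
      refine convexHull_min ?_ (convex_halfSpace_ge ξ.isLinear _)
      rintro _ ⟨k, rfl⟩
      exact hk₀ k
    exact hsub hz
  have hpos : ∀ i, 0 < ξ (b k₀ i) := by
    intro i
    refine lt_of_le_of_ne ?_ (hξ k₀ i).symm
    obtain ⟨t, ht, hm⟩ := h.exists_mem k₀ i
    have := hle _ hm
    rw [map_add, map_smul, smul_eq_mul] at this
    exact nonneg_of_mul_nonneg_right (by linarith) ht
  have hW : ∀ k i, halfWeight ((b k).repr (y - v k) i) (ξ (b k i))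
      = if ξ (b k i) < 0 then 0 else 1 := by
    intro k i
    rw [halfWeight, if_pos (h.coord_nonneg k y hy i), if_neg (hξ k i)]
    split_ifs <;> simp
  rw [vertexSum, Finset.sum_eq_single k₀]
  · exact Finset.prod_eq_one fun i _ => by rw [hW, if_neg (hpos i).le.not_gt]
  · intro k _ hk
    obtain ⟨i, hi⟩ : ∃ i, ξ (b k i) < 0 := by
      by_contra! hall
      apply hk
      apply h.injective
      have hz : ∑ i, (b k).repr (v k₀ - v k) i * ξ (b k i) = ξ (v k₀) - ξ (v k) := by
        rw [← map_sub]
        conv_rhs => rw [← (b k).sum_repr (v k₀ - v k)]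
        rw [map_sum]
        exact Finset.sum_congr rfl fun i _ => by rw [map_smul, smul_eq_mul]
      have hnn : ∀ i ∈ Finset.univ, 0 ≤ (b k).repr (v k₀ - v k) i * ξ (b k i) := fun i _ =>
        mul_nonneg (h.coord_nonneg k _ (h.mem k₀) i) (hall i)
      have h0 : ∑ i, (b k).repr (v k₀ - v k) i * ξ (b k i) = 0 :=
        le_antisymm (by rw [hz]; linarith [hk₀ k]) (Finset.sum_nonneg hnn)
      rw [Finset.sum_eq_zero_iff_of_nonneg hnn] at h0
      have h1 : v k₀ - v k = 0 := by
        apply (b k).repr.injective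
        ext i
        simpa [hξ] using h0 i (Finset.mem_univ i)
      exact (sub_eq_zero.1 h1).symm
    exact Finset.prod_eq_zero (Finset.mem_univ i) (by rw [hW, if_pos hi])
  · simp

end VertexSum

section PolyhedralSeries

/-- The translate `x^a · S` of a formal series. -/
def shiftSeries (d : ℕ) (a : Fin d → ℤ) (S : (Fin d → ℤ) → ℂ) : (Fin d → ℤ) → ℂ :=
  fun m => S (m - a)

theorem actLP_single (d : ℕ) (a : Fin d → ℤ) (c : ℂ) (S : (Fin d → ℤ) → ℂ) :
    actLP d (Finsupp.single a c) S = c • shiftSeries d a S := by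
  funext m
  change (Finsupp.single a c).sum (fun w c => c * S (m - w)) = c * S (m - a)
  rw [Finsupp.sum_single_index (by rw [zero_mul])]

theorem toRat_single (d : ℕ) (a : Fin d → ℤ) (c : ℂ) :
    toRat d (Finsupp.single a c)
      = algebraMap (MvPolynomial (Fin d) ℂ) (RatF d) (MvPolynomial.C c) * ratMon d a := by
  change (Finsupp.single a c).sum
    (fun w c => algebraMap (MvPolynomial (Fin d) ℂ) (RatF d) (MvPolynomial.C c) * ratMon d w) = _
  rw [Finsupp.sum_single_index (by rw [map_zero, map_zero, zero_mul])]

theorem toR_sub (d : ℕ) (m a : Fin d → ℤ) : toR d (m - a) = toR d m - toR d a := by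
  funext i
  simp [toR]

theorem ratMon_zero (d : ℕ) : ratMon d 0 = 1 := by simp [ratMon]

theorem ratMon_single (d : ℕ) (i : Fin d) : ratMon d (Pi.single i 1)
    = algebraMap (MvPolynomial (Fin d) ℂ) (RatF d) (MvPolynomial.X i) := by
  rw [ratMon, Finset.prod_eq_single i]
  · simp
  · intro j _ hj
    rw [Pi.single_eq_of_ne hj, zpow_zero]
  · simp

theorem one_sub_ratMon_single_ne_zero (d : ℕ) (i : Fin d) :
    1 - ratMon d (Pi.single i 1) ≠ 0 := by
  rw [ratMon_single, ← map_one (algebraMap (MvPolynomial (Fin d) ℂ) (RatF d)), ← map_sub]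
  rw [Ne, FaithfulSMul.algebraMap_eq_zero_iff]
  intro h
  have := congrArg (MvPolynomial.eval (0 : Fin d → ℂ)) h
  simp at this

theorem shiftSeries_genSeries_coneSet (d : ℕ) (a : Fin d → ℤ) (v : Fin d → ℝ)
    (w : Fin d → Fin d → ℤ) : shiftSeries d a (genSeries d (coneSet d d v w))
      = genSeries d (coneSet d d (v + toR d a) w) := by
  funext m
  have h : toR d (m - a) ∈ coneSet d d v w ↔ toR d m ∈ coneSet d d (v + toR d a) w := by
    simp only [coneSet, Set.mem_ofPred_eq, toR_sub, sub_eq_iff_eq_add, add_right_comm v]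
  by_cases hm : toR d m ∈ coneSet d d (v + toR d a) w
  · exact (if_pos (h.2 hm)).trans (if_pos hm).symm
  · exact (if_neg (mt h.1 hm)).trans (if_neg hm).symm

/-- The complex span of the series of simple rational cones. -/
def simpleConeSpan (d : ℕ) : Submodule ℂ ((Fin d → ℤ) → ℂ) :=
  Submodule.span ℂ {S | ∃ K, IsSimpleCone d K ∧ S = genSeries d K}

theorem genSeries_mem_simpleConeSpan {d : ℕ} {K : Set (Fin d → ℝ)} (hK : IsSimpleCone d K) :
    genSeries d K ∈ simpleConeSpan d :=
  Submodule.subset_span ⟨K, hK, rfl⟩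

theorem shiftSeries_mem_simpleConeSpan {d : ℕ} (a : Fin d → ℤ) {S : (Fin d → ℤ) → ℂ}
    (hS : S ∈ simpleConeSpan d) : shiftSeries d a S ∈ simpleConeSpan d := by
  induction hS using Submodule.span_induction with
  | mem S h =>
    obtain ⟨K, ⟨v, w, hw, rfl⟩, rfl⟩ := h
    rw [shiftSeries_genSeries_coneSet]
    exact genSeries_mem_simpleConeSpan ⟨_, w, hw, rfl⟩
  | zero => exact (simpleConeSpan d).zero_mem
  | add S T _ _ hS hT => exact (simpleConeSpan d).add_mem hS hT
  | smul c S _ hS => exact (simpleConeSpan d).smul_mem c hS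

theorem memPL_of_mem_simpleConeSpan {d : ℕ} {S : (Fin d → ℤ) → ℂ}
    (hS : S ∈ simpleConeSpan d) : MemPL d S := by
  rw [simpleConeSpan, Submodule.mem_span_set'] at hS
  obtain ⟨n, c, T, rfl⟩ := hS
  choose K hK hT using fun i => (T i).2
  refine ⟨n, fun i => Finsupp.single 0 (c i), K, hK, Finset.sum_congr rfl fun i _ => ?_⟩
  rw [actLP_single, hT]
  congr 1
  funext m
  simp [shiftSeries]

variable {d : ℕ} {φ : ((Fin d → ℤ) → ℂ) → RatF d}

theorem IsPhi.map_smul (hφ : IsPhi d φ) (c : ℂ) {S : (Fin d → ℤ) → ℂ}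
    (hS : S ∈ simpleConeSpan d) : φ (c • S)
      = algebraMap (MvPolynomial (Fin d) ℂ) (RatF d) (MvPolynomial.C c) * φ S := by
  have h := hφ.2.1 (Finsupp.single 0 c) S (memPL_of_mem_simpleConeSpan hS)
  rw [actLP_single, toRat_single, ratMon_zero, mul_one] at h
  rw [← h]
  congr 2
  funext m
  simp [shiftSeries]

theorem IsPhi.map_shiftSeries (hφ : IsPhi d φ) (a : Fin d → ℤ) {S : (Fin d → ℤ) → ℂ}
    (hS : S ∈ simpleConeSpan d) : φ (shiftSeries d a S) = ratMon d a * φ S := by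
  have h := hφ.2.1 (Finsupp.single a 1) S (memPL_of_mem_simpleConeSpan hS)
  rwa [actLP_single, toRat_single, map_one, map_one, one_mul, one_smul] at h

theorem IsPhi.map_add (hφ : IsPhi d φ) {S T : (Fin d → ℤ) → ℂ}
    (hS : S ∈ simpleConeSpan d) (hT : T ∈ simpleConeSpan d) : φ (S + T) = φ S + φ T :=
  hφ.1 S T (memPL_of_mem_simpleConeSpan hS) (memPL_of_mem_simpleConeSpan hT)

theorem IsPhi.map_sub (hφ : IsPhi d φ) {S T : (Fin d → ℤ) → ℂ}
    (hS : S ∈ simpleConeSpan d) (hT : T ∈ simpleConeSpan d) : φ (S - T) = φ S - φ T := by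
  have h := hφ.map_add ((simpleConeSpan d).sub_mem hS hT) hT
  rw [sub_add_cancel] at h
  rw [h, add_sub_cancel_right]

theorem IsPhi.map_sum (hφ : IsPhi d φ) {α : Type*} (s : Finset α) (S : α → (Fin d → ℤ) → ℂ)
    (hS : ∀ a ∈ s, S a ∈ simpleConeSpan d) : φ (∑ a ∈ s, S a) = ∑ a ∈ s, φ (S a) := by
  induction s using Finset.induction_on with
  | empty =>
    have h := hφ.map_smul 0 (simpleConeSpan d).zero_mem
    simpa using h
  | insert a s ha ih =>
    rw [Finset.sum_insert ha, Finset.sum_insert ha, hφ.map_add (hS a (Finset.mem_insert_self a s))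
      ((simpleConeSpan d).sum_mem fun b hb => hS b (Finset.mem_insert_of_mem hb)),
      ih fun b hb => hS b (Finset.mem_insert_of_mem hb)]

/-- The series of the face of the nonnegative orthant on which the coordinates in `J` vanish. -/
def orthantFaceSeries (d : ℕ) (J : Finset (Fin d)) : (Fin d → ℤ) → ℂ :=
  fun m => if ∀ i, 0 ≤ m i ∧ (i ∈ J → m i = 0) then 1 else 0

theorem orthantFaceSeries_insert {J : Finset (Fin d)} {i : Fin d} (hi : i ∉ J) :
    orthantFaceSeries d (insert i J)
      = orthantFaceSeries d J - shiftSeries d (Pi.single i 1) (orthantFaceSeries d J) := by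
  funext m
  simp only [Pi.sub_apply, shiftSeries, orthantFaceSeries]
  have h1 : (∀ j, 0 ≤ m j - (Pi.single i 1 : Fin d → ℤ) j ∧
      (j ∈ J → m j - (Pi.single i 1 : Fin d → ℤ) j = 0)) ↔
      (1 ≤ m i ∧ ∀ j, 0 ≤ m j ∧ (j ∈ J → m j = 0)) := by
    constructor
    · intro h
      have hmi := (h i).1
      rw [Pi.single_eq_same] at hmi
      refine ⟨by lia, fun j => ?_⟩
      by_cases hj : j = i
      · subst hj
        exact ⟨by lia, fun h => absurd h hi⟩
      · simpa [hj] using h j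
    · rintro ⟨hmi, h⟩ j
      by_cases hj : j = i
      · subst hj
        exact ⟨by simpa using hmi, fun h => absurd h hi⟩
      · simpa [hj] using h j
  have h2 : (∀ j, 0 ≤ m j ∧ (j ∈ insert i J → m j = 0)) ↔
      (m i = 0 ∧ ∀ j, 0 ≤ m j ∧ (j ∈ J → m j = 0)) := by
    constructor
    · intro h
      exact ⟨(h i).2 (Finset.mem_insert_self i J), fun j =>
        ⟨(h j).1, fun hj => (h j).2 (Finset.mem_insert_of_mem hj)⟩⟩
    · rintro ⟨hmi, h⟩ j
      refine ⟨(h j).1, fun hj => ?_⟩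
      rcases Finset.mem_insert.1 hj with rfl | hj
      · exact hmi
      · exact (h j).2 hj
  have h3 : (∀ j, 0 ≤ m j ∧ (j ∈ J → m j = 0)) → 0 ≤ m i := fun h => (h i).1
  simp only [h1, h2]
  by_cases h : ∀ j, 0 ≤ m j ∧ (j ∈ J → m j = 0)
  · rw [if_pos h]
    rcases (h3 h).eq_or_lt with h0 | h0
    · rw [if_pos ⟨h0.symm, h⟩, if_neg fun h' => by lia, sub_zero]
    · rw [if_neg fun h' => h0.ne' h'.1, if_pos ⟨h0, h⟩, sub_self]
  · rw [if_neg h, if_neg fun h' => h h'.2, if_neg fun h' => h h'.2, sub_zero]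

theorem linearIndependent_toR_single (d : ℕ) :
    LinearIndependent ℝ fun i : Fin d => toR d (Pi.single i 1) := by
  convert (Pi.basisFun ℝ (Fin d)).linearIndependent using 2 with i
  funext j
  simp [toR, Pi.single_apply]

theorem sum_smul_toR_single (d : ℕ) (lam : Fin d → ℝ) :
    ∑ i, lam i • toR d (Pi.single i 1) = lam := by
  funext j
  simp [toR, Pi.single_apply]

theorem genSeries_orthant (d : ℕ) :
    genSeries d (coneSet d d 0 fun i => Pi.single i 1) = orthantFaceSeries d ∅ := by
  funext m
  simp only [genSeries, orthantFaceSeries, coneSet, Set.mem_ofPred_eq, sum_smul_toR_single, zero_add]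
  congr 1
  simp only [exists_eq_right', Finset.notMem_empty, false_imp_iff, and_true, eq_iff_iff]
  exact forall_congr' fun i => Int.cast_nonneg_iff

theorem sigmaSet_unitCube (d : ℕ) : sigmaSet d (parSet d 0 fun i => Pi.single i 1) = 1 := by
  have h : {m : Fin d → ℤ | toR d m ∈ parSet d 0 fun i => Pi.single i 1} = {0} := by
    ext m
    simp only [parSet, Set.mem_ofPred_eq, sum_smul_toR_single, zero_add, exists_eq_right',
      Set.mem_singleton_iff, toR]
    constructor
    · intro h
      funext i
      have h1 : (0 : ℤ) ≤ m i := by exact_mod_cast (h i).1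
      have h2 : m i < 1 := by exact_mod_cast (h i).2
      simp only [Pi.zero_apply]
      lia
    · rintro rfl
      simp
  rw [sigmaSet, h, finsum_mem_singleton, ratMon_zero]

theorem IsPhi.map_orthantFaceSeries (hφ : IsPhi d φ) (J : Finset (Fin d)) :
    orthantFaceSeries d J ∈ simpleConeSpan d ∧
      φ (orthantFaceSeries d J) = (∏ i ∈ J, (1 - ratMon d (Pi.single i 1))) /
        ∏ i, (1 - ratMon d (Pi.single i 1)) := by
  induction J using Finset.induction_on with
  | empty =>
    rw [← genSeries_orthant]
    exact ⟨genSeries_mem_simpleConeSpan ⟨_, _, linearIndependent_toR_single d, rfl⟩, by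
      rw [hφ.2.2 _ _ (linearIndependent_toR_single d), sigmaSet_unitCube, Finset.prod_empty]⟩
  | insert i J hi ih =>
    have hs := shiftSeries_mem_simpleConeSpan (Pi.single i 1) ih.1
    rw [orthantFaceSeries_insert hi, Finset.prod_insert hi]
    refine ⟨(simpleConeSpan d).sub_mem ih.1 hs, ?_⟩
    rw [hφ.map_sub ih.1 hs, hφ.map_shiftSeries _ ih.1, ih.2]
    ring

theorem IsPhi.map_orthantFaceSeries_univ (hφ : IsPhi d φ) :
    φ (orthantFaceSeries d Finset.univ) = 1 := by
  rw [(hφ.map_orthantFaceSeries Finset.univ).2]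
  exact div_self (Finset.prod_ne_zero_iff.2 fun i _ => one_sub_ratMon_single_ne_zero d i)

theorem finite_integer_points {P : Set (Fin d → ℝ)} (hP : Bornology.IsBounded P) :
    {m : Fin d → ℤ | toR d m ∈ P}.Finite := by
  obtain ⟨R, hR⟩ := hP.subset_closedBall 0
  refine (Set.finite_Icc (fun _ : Fin d => -⌈R⌉) fun _ => ⌈R⌉).subset fun m hm => ?_
  have h := mem_closedBall_zero_iff.1 (hR hm)
  have hi : ∀ i, |(m i : ℝ)| ≤ ⌈R⌉ := fun i =>
    ((norm_le_pi_norm (toR d m) i).trans h).trans (Int.le_ceil R)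
  refine ⟨fun i => ?_, fun i => ?_⟩
  · exact_mod_cast (abs_le.1 (hi i)).1
  · exact_mod_cast (abs_le.1 (hi i)).2

/-- On series of bounded sets, `φ` is evaluation as a Laurent polynomial. -/
theorem IsPhi.map_genSeries_of_isBounded (hφ : IsPhi d φ) {P : Set (Fin d → ℝ)}
    (hP : Bornology.IsBounded P) : φ (genSeries d P) = sigmaSet d P := by
  have hfin := finite_integer_points hP
  have hmem := (hφ.map_orthantFaceSeries Finset.univ).1
  have hsum : genSeries d P
      = ∑ a ∈ hfin.toFinset, shiftSeries d a (orthantFaceSeries d Finset.univ) := by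
    funext m
    have h : ∀ a, shiftSeries d a (orthantFaceSeries d Finset.univ) m
        = if m = a then 1 else 0 := by
      intro a
      simp only [shiftSeries, orthantFaceSeries]
      congr 1
      rw [eq_iff_iff]
      constructor
      · intro h
        funext i
        exact sub_eq_zero.1 ((h i).2 (Finset.mem_univ i))
      · rintro rfl i
        simp
    rw [Finset.sum_apply, Finset.sum_congr rfl fun a _ => h a, Finset.sum_ite_eq]
    simp [genSeries]
  rw [hsum, hφ.map_sum _ _ fun a _ => shiftSeries_mem_simpleConeSpan a hmem, sigmaSet,
    finsum_mem_eq_finite_toFinset_sum _ hfin]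
  exact Finset.sum_congr rfl fun a _ => by
    rw [hφ.map_shiftSeries a hmem, hφ.map_orthantFaceSeries_univ, mul_one]

end PolyhedralSeries

section HalfOpenCones

/-- The linear functional `dotR d xi`. -/
def dotDual (d : ℕ) (xi : Fin d → ℝ) : Module.Dual ℝ (Fin d → ℝ) :=
  ∑ i, xi i • LinearMap.proj i

theorem dotDual_apply (d : ℕ) (xi y : Fin d → ℝ) : dotDual d xi y = dotR d xi y := by
  simp [dotDual, dotR]

variable {d : ℕ} {w : Fin d → Fin d → ℤ} {B : Module.Basis (Fin d) ℝ (Fin d → ℝ)}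

theorem mem_coneSet_iff (hB : ∀ i, B i = toR d (w i)) (v y : Fin d → ℝ) :
    y ∈ coneSet d d v w ↔ ∀ i, 0 ≤ B.repr (y - v) i := by
  simp only [coneSet, Set.mem_ofPred_eq, ← hB]
  constructor
  · rintro ⟨lam, hlam, rfl⟩ i
    rw [add_sub_cancel_left, B.repr_sum_self]
    exact hlam i
  · intro h
    refine ⟨_, h, ?_⟩
    rw [B.sum_repr, add_sub_cancel]

theorem mem_lvCone_iff (hB : ∀ i, B i = toR d (w i)) (v y xi : Fin d → ℝ) :
    y ∈ lvCone d v w xi ↔ ∀ i, (0 < dotR d xi (B i) → 0 ≤ B.repr (y - v) i) ∧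
      (dotR d xi (B i) < 0 → B.repr (y - v) i < 0) := by
  simp only [lvCone, Set.mem_ofPred_eq, ← hB]
  constructor
  · rintro ⟨lam, hlam, rfl⟩ i
    rw [add_sub_cancel_left, B.repr_sum_self]
    exact hlam i
  · intro h
    refine ⟨_, h, ?_⟩
    rw [B.sum_repr, add_sub_cancel]

/-- The coordinates of integer points in an integral basis have bounded denominators. -/
theorem exists_den_repr_toR (hB : ∀ i, B i = toR d (w i)) :
    ∃ D : ℤ, 0 < D ∧ ∀ m i, ∃ n : ℤ, D * B.repr (toR d m) i = n := by
  set M : Matrix (Fin d) (Fin d) ℤ := Matrix.of w with hM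
  set R : Matrix (Fin d) (Fin d) ℝ := M.map (Int.castRingHom ℝ) with hR
  have hrow : R.row = fun i => B i := by
    funext i j
    simp [hR, hM, hB, toR]
  have hdet : M.det ≠ 0 := by
    have h1 : IsUnit R := by
      rw [← Matrix.linearIndependent_rows_iff_isUnit, hrow]
      exact B.linearIndependent
    have h2 := ((Matrix.isUnit_iff_isUnit_det R).1 h1).ne_zero
    intro h0
    apply h2
    rw [hR, ← RingHom.mapMatrix_apply, ← RingHom.map_det, h0, map_zero]
  refine ⟨M.det * M.det, mul_self_pos.2 hdet, fun m i =>
    ⟨M.det * Matrix.vecMul m M.adjugate i, ?_⟩⟩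
  have hlam : Matrix.vecMul (fun i => B.repr (toR d m) i) R = toR d m := by
    conv_rhs => rw [← B.sum_repr (toR d m)]
    rw [Matrix.vecMul_eq_sum]
    refine Finset.sum_congr rfl fun i _ => ?_
    exact congrArg _ (congrFun hrow i)
  have hadj : Matrix.vecMul (toR d m) R.adjugate i = R.det * B.repr (toR d m) i := by
    conv_lhs => rw [← hlam, Matrix.vecMul_vecMul, Matrix.mul_adjugate, Matrix.vecMul_smul,
      Matrix.vecMul_one]
    rfl
  have hRdet : R.det = M.det := by
    rw [hR, ← RingHom.mapMatrix_apply, ← RingHom.map_det]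
    rfl
  have hRadj : R.adjugate = M.adjugate.map (Int.castRingHom ℝ) := by
    rw [hR, ← RingHom.mapMatrix_apply, ← RingHom.map_adjugate]
    rfl
  rw [hRdet, hRadj] at hadj
  rw [Int.cast_mul, Int.cast_mul, mul_assoc, ← hadj]
  congr 1
  simp [Matrix.vecMul, dotProduct, toR]

theorem exists_repr_le_neg (hB : ∀ i, B i = toR d (w i)) (v : Fin d → ℝ) (i : Fin d) :
    ∃ ε : ℝ, 0 < ε ∧ ∀ m, B.repr (toR d m - v) i < 0 → B.repr (toR d m - v) i ≤ -ε := by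
  obtain ⟨D, hD, hn⟩ := exists_den_repr_toR hB
  have hD' : (0 : ℝ) < D := by exact_mod_cast hD
  set c := B.repr v i with hc
  refine ⟨(D * c - (⌈D * c⌉ - 1)) / D, ?_, fun m hm => ?_⟩
  · have := Int.ceil_lt_add_one (D * c)
    apply div_pos _ hD'
    linarith
  · obtain ⟨n, hn⟩ := hn m i
    simp only [map_sub, Finsupp.sub_apply, ← hc] at hm ⊢
    have h1 : (n : ℝ) < D * c := by
      rw [← hn]
      exact mul_lt_mul_of_pos_left (by linarith) hD'
    have h2 : n ≤ ⌈D * c⌉ - 1 := Int.le_sub_one_of_lt (Int.lt_ceil.2 h1)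
    have h3 : (n : ℝ) ≤ ⌈D * c⌉ - 1 := by exact_mod_cast h2
    rw [← neg_div, le_div_iff₀ hD', sub_mul, mul_comm _ (D : ℝ), hn]
    linarith

/-- Half-open vertex cones have the same integer points as suitable closed simple cones. -/
theorem genSeries_lvCone_mem_simpleConeSpan (hw : LinearIndependent ℝ fun i => toR d (w i))
    (v xi : Fin d → ℝ) (hxi : ∀ i, dotR d xi (toR d (w i)) ≠ 0) :
    genSeries d (lvCone d v w xi) ∈ simpleConeSpan d := by
  let B := basisOfPiSpaceOfLinearIndependent hw
  have hB : ∀ i, B i = toR d (w i) := fun i => by simp [B]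
  choose ε hε hεm using exists_repr_le_neg hB v
  let neg : Fin d → Prop := fun i => dotR d xi (toR d (w i)) < 0
  let u : Fin d → ℤˣ := fun i => if neg i then -1 else 1
  let w' : Fin d → Fin d → ℤ := fun i => (u i : ℤ) • w i
  let s : Fin d → ℝˣ := fun i => if neg i then -1 else 1
  have hw' : ∀ i, toR d (w' i) = B.unitsSMul s i := by
    intro i
    rw [Module.Basis.unitsSMul_apply, hB]
    funext j
    by_cases hi : neg i <;> simp [w', u, s, hi, toR]
  have hlin : LinearIndependent ℝ fun i => toR d (w' i) := by
    simp only [hw']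
    exact (B.unitsSMul s).linearIndependent
  let v' : Fin d → ℝ := v - ∑ i, (if neg i then ε i else 0) • B i
  have heq : genSeries d (lvCone d v w xi) = genSeries d (coneSet d d v' w') := by
    funext m
    simp only [genSeries]
    congr 1
    rw [eq_iff_iff, mem_lvCone_iff hB, mem_coneSet_iff fun i => (hw' i).symm]
    refine forall_congr' fun i => ?_
    have hrepr : B.repr (toR d m - v') i
        = B.repr (toR d m - v) i + if neg i then ε i else 0 := by
      simp only [v', sub_sub_eq_add_sub, add_sub_right_comm, map_add, Finsupp.add_apply]
      rw [B.repr_sum_self]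
    rw [Module.Basis.repr_unitsSMul, hrepr, hB]
    by_cases hi : neg i
    · have hi' : dotR d xi (toR d (w i)) < 0 := hi
      simp only [hi', hi'.not_gt, s, hi, if_true, false_imp_iff, true_and, true_imp_iff]
      simp only [inv_neg, inv_one, Units.smul_def, Units.val_neg, Units.val_one, neg_smul,
        one_smul]
      constructor
      · intro h
        linarith [hεm i m h]
      · intro h
        linarith [hε i]
    · have hi' : 0 < dotR d xi (toR d (w i)) := lt_of_le_of_ne (not_lt.1 hi) (hxi i).symm
      simp [hi', hi'.not_gt, s, hi]
  rw [heq]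
  exact genSeries_mem_simpleConeSpan ⟨v', w', hlin, rfl⟩

theorem prod_halfWeight (hB : ∀ i, B i = toR d (w i)) (v xi : Fin d → ℝ)
    (hxi : ∀ i, dotR d xi (toR d (w i)) ≠ 0) (m : Fin d → ℤ) :
    ∏ i, halfWeight (B.repr (toR d m - v) i) (dotDual d xi (B i))
      = (-1) ^ (Finset.univ.filter fun i => dotR d xi (toR d (w i)) < 0).card *
        genSeries d (lvCone d v w xi) m := by
  have hfac : ∀ i, halfWeight (B.repr (toR d m - v) i) (dotDual d xi (B i))
      = (if dotR d xi (toR d (w i)) < 0 then -1 else 1) *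
        if (0 < dotR d xi (B i) → 0 ≤ B.repr (toR d m - v) i) ∧
          (dotR d xi (B i) < 0 → B.repr (toR d m - v) i < 0) then 1 else 0 := by
    intro i
    rw [dotDual_apply, hB]
    generalize B.repr (toR d m - v) i = lam
    rcases lt_or_gt_of_ne (hxi i) with h | h
    · by_cases h0 : lam < 0
      · simp [halfWeight, h, h.not_gt, h0]
      · simp [halfWeight, h, h.not_gt, h0, not_lt.1 h0]
    · simp [halfWeight, h, h.not_gt, h.ne']
  rw [Finset.prod_congr rfl fun i _ => hfac i, Finset.prod_mul_distrib, Finset.prod_ite,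
    Finset.prod_const, Finset.prod_const_one, mul_one, Finset.prod_ite_zero]
  simp [genSeries, mem_lvCone_iff hB]

end HalfOpenCones

theorem isSimpleVertexSystem_of_tangentCones {d N : ℕ} {v : Fin N → Fin d → ℝ}
    {w : Fin N → Fin d → Fin d → ℤ} (hinj : Function.Injective v)
    (hvert : Set.range v = Set.extremePoints ℝ (convexHull ℝ (Set.range v)))
    {B : Fin N → Module.Basis (Fin d) ℝ (Fin d → ℝ)} (hB : ∀ k i, B k i = toR d (w k i))
    (hcone : ∀ k, {y | ∃ t : ℝ, 0 < t ∧ v k + t • (y - v k) ∈ convexHull ℝ (Set.range v)}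
        = coneSet d d (v k) (w k)) :
    IsSimpleVertexSystem (convexHull ℝ (Set.range v)) v B where
  injective := hinj
  eq_hull := rfl
  range_eq := hvert
  coord_nonneg k y hy := by
    rw [← mem_coneSet_iff (hB k), ← hcone k]
    exact ⟨1, one_pos, by simpa using hy⟩
  exists_mem k i := by
    have h : v k + B k i ∈ coneSet d d (v k) (w k) := by
      rw [mem_coneSet_iff (hB k), add_sub_cancel_left, Module.Basis.repr_self]
      intro j
      rw [Finsupp.single_apply]
      split_ifs <;> simp
    rw [← hcone k] at h
    obtain ⟨t, ht, hm⟩ := h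
    exact ⟨t, ht, by simpa using hm⟩

/-- **Lawrence–Varchenko Formula.** Let `P ⊂ ℝ^d` be a simple
full-dimensional polytope with rational vertices `v₁,…,v_N`, at each vertex `v k` let
`w k 1, …, w k d` be the (linearly independent) edge directions, so the vertex tangent
cone is `coneSet d d (v k) (w k)`, and let `ξ` be nonperpendicular to all edge directions.
Then `σ_P(x) = Σ_k (-1)^{|E⁻_{v k}(ξ)|} φ(S_{K_{ξ,v k}})` in `ℂ(x₁,…,x_d)`. -/
theorem statement9 (d N : ℕ) (v : Fin N → Fin d → ℝ) (hinj : Function.Injective v)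
    (w : Fin N → Fin d → Fin d → ℤ) (xi : Fin d → ℝ)
    (hrat : ∀ k i, ∃ q : ℚ, v k i = (q : ℝ))
    (hvert : Set.range v = Set.extremePoints ℝ (convexHull ℝ (Set.range v)))
    (hfull : (interior (convexHull ℝ (Set.range v))).Nonempty)
    (hsimple : ∀ k, LinearIndependent ℝ (fun i => toR d (w k i)))
    (hcone : ∀ k, {y | ∃ t : ℝ, 0 < t ∧ v k + t • (y - v k) ∈ convexHull ℝ (Set.range v)}
        = coneSet d d (v k) (w k))
    (hxi : ∀ k i, dotR d xi (toR d (w k i)) ≠ 0)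
    (φ : ((Fin d → ℤ) → ℂ) → RatF d) (hφ : IsPhi d φ) :
    sigmaSet d (convexHull ℝ (Set.range v)) =
      ∑ k, (-1 : RatF d) ^
            (Finset.univ.filter (fun i => dotR d xi (toR d (w k i)) < 0)).card *
          φ (genSeries d (lvCone d (v k) (w k) xi)) := by
  let B := fun k => basisOfPiSpaceOfLinearIndependent (hsimple k)
  have hB : ∀ k i, B k i = toR d (w k i) := fun k i => by simp [B]
  have hsys := isSimpleVertexSystem_of_tangentCones hinj hvert hB hcone
  have hmem := fun k => genSeries_lvCone_mem_simpleConeSpan (hsimple k) (v k) xi (hxi k)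
  have hdual : ∀ k i, dotDual d xi (B k i) ≠ 0 := fun k i => by
    rw [dotDual_apply, hB]
    exact hxi k i
  have hseries : genSeries d (convexHull ℝ (Set.range v)) = ∑ k,
      ((-1 : ℂ) ^ (Finset.univ.filter (fun i => dotR d xi (toR d (w k i)) < 0)).card) •
        genSeries d (lvCone d (v k) (w k) xi) := by
    funext m
    have hsum : genSeries d (convexHull ℝ (Set.range v)) m
        = vertexSum v B (toR d m) (dotDual d xi) := by
      rw [genSeries]
      split_ifs with hm
      · exact (vertexSum_of_mem hsys hm hdual).symm
      · exact (vertexSum_of_notMem hsys hm hdual).symm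
    rw [hsum, vertexSum, Finset.sum_apply]
    exact Finset.sum_congr rfl fun k _ => prod_halfWeight (hB k) (v k) xi (hxi k) m
  have hbdd : Bornology.IsBounded (convexHull ℝ (Set.range v)) :=
    ((Set.finite_range v).isCompact_convexHull ℝ).isBounded
  rw [← hφ.map_genSeries_of_isBounded hbdd, hseries,
    hφ.map_sum _ _ fun k _ => (simpleConeSpan d).smul_mem _ (hmem k)]
  refine Finset.sum_congr rfl fun k _ => ?_
  rw [hφ.map_smul _ (hmem k)]
  simp only [map_pow, map_neg, map_one]

end
end

section
/- (Irrational decomposition of a polytope) Let P ⊂ ℝ^d be a full-dimensional polytope with rational vertices, decomposed as P = P_1 ∪ ⋯ ∪ P_l into d-simplices with pairwise disjoint interiors whose vertices are vertices of P. Then there exist ε > 0 and s ∈ ℝ^d such that, setting P' := s + (1+ε)P and P'_i := s + (1+ε)P_i, one has: P' ∩ ℤ^d = P ∩ ℤ^d; no hyperplane containing a facet of some P'_i contains an integer point; for every vertex v of P, with v' := (1+ε)v + s, the vertex tangent cones satisfy K(P')_{v'} ∩ ℤ^d = K(P)_v ∩ ℤ^d; and P' ∩ ℤ^d is the disjoint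 union of the sets P'_1 ∩ ℤ^d, …, P'_l ∩ ℤ^d. -/
open scoped BigOperators Classical

noncomputable section

open Topology Filter

/-- The tangent cone of a convex set `P` at a point `x`, with apex `x`. -/
def vertexCone (d : ℕ) (P : Set (Fin d → ℝ)) (x : Fin d → ℝ) : Set (Fin d → ℝ) :=
  {y | ∃ τ : ℝ, 0 < τ ∧ x + τ • (y - x) ∈ P}

theorem isClosedEmbedding_toR (d : ℕ) : IsClosedEmbedding (toR d) :=
  IsClosedEmbedding.piMap fun _ => Int.isClosedEmbedding_coe_real

/-- An integer point which is close enough to a compact set lies in it. -/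
theorem eventually_toR_mem_of_add_mem (d : ℕ) {K : Set (Fin d → ℝ)} (hK : IsCompact K) :
    ∀ᶠ δ in 𝓝[>] (0 : ℝ), ∀ (m : Fin d → ℤ) (v : Fin d → ℝ), ‖v‖ < δ →
      toR d m + v ∈ K → toR d m ∈ K := by
  have hL : IsClosed (toR d '' {m | toR d m ∉ K}) :=
    (isClosedEmbedding_toR d).isClosedMap _ (isClosed_discrete _)
  have hdis : Disjoint K (toR d '' {m | toR d m ∉ K}) := by
    rw [Set.disjoint_left]
    rintro _ hx ⟨m, hm, rfl⟩
    exact hm hx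
  obtain ⟨δ, hδ, h⟩ := hdis.exists_thickenings hK hL
  filter_upwards [Ioo_mem_nhdsGT hδ] with η hη m v hv hmv
  by_contra hm
  refine Set.disjoint_left.1 h (Metric.self_subset_thickening hδ _ hmv) ?_
  refine Metric.mem_thickening_iff.2 ⟨toR d m, ⟨m, hm, rfl⟩, ?_⟩
  simpa using hv.trans hη.2

/-- Finitely many rational points have a common denominator. -/
theorem exists_common_denominator (d : ℕ) (V : Finset (Fin d → ℝ))
    (hrat : ∀ x ∈ V, ∀ i, ∃ q : ℚ, x i = (q : ℝ)) :
    ∃ N : ℕ, 0 < N ∧ ∀ x ∈ V, ∃ z : Fin d → ℤ, toR d z = (N : ℝ) • x := by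
  choose! q hq using hrat
  refine ⟨∏ x ∈ V, ∏ i, (q x i).den, Finset.prod_pos fun x _ => Finset.prod_pos fun i _ =>
    (q x i).den_pos, fun x hx => ?_⟩
  have hdvd : ∀ i, (q x i).den ∣ ∏ x ∈ V, ∏ i, (q x i).den := fun i =>
    (Finset.dvd_prod_of_mem (fun i => (q x i).den) (Finset.mem_univ i)).trans
      (Finset.dvd_prod_of_mem (fun x => ∏ i, (q x i).den) hx)
  choose k hk using hdvd
  refine ⟨fun i => (q x i).num * k i, funext fun i => ?_⟩
  have hden : ((q x i).den : ℝ) ≠ 0 := by exact_mod_cast (q x i).den_ne_zero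
  have hx' : x i = (q x i).num / (q x i).den := by
    rw [hq x hx i]
    exact Rat.cast_def _
  simp only [toR, Pi.smul_apply, smul_eq_mul, hk i, hx']
  push_cast
  field_simp

theorem mem_vertexCone_convexHull_iff (d : ℕ) (V : Finset (Fin d → ℝ)) {x : Fin d → ℝ}
    (hx : x ∈ V) (y : Fin d → ℝ) :
    y ∈ vertexCone d (convexHull ℝ (V : Set (Fin d → ℝ))) x ↔
      ∃ lam : (Fin d → ℝ) → ℝ, (∀ w, 0 ≤ lam w) ∧ y = x + ∑ w ∈ V, lam w • (w - x) := by
  constructor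
  · rintro ⟨τ, hτ, h⟩
    rw [Finset.mem_convexHull'] at h
    obtain ⟨a, ha0, ha1, ha⟩ := h
    refine ⟨fun w => if w ∈ V then a w / τ else 0, fun w => ?_, ?_⟩
    · dsimp only
      split_ifs with hw
      · exact div_nonneg (ha0 w hw) hτ.le
      · exact le_rfl
    · have h1 : ∑ w ∈ V, (if w ∈ V then a w / τ else 0) • (w - x)
          = τ⁻¹ • ∑ w ∈ V, a w • (w - x) := by
        rw [Finset.smul_sum]
        refine Finset.sum_congr rfl fun w hw => ?_
        rw [if_pos hw, smul_smul, div_eq_inv_mul]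
      have h2 : ∑ w ∈ V, a w • (w - x) = τ • (y - x) := by
        simp only [smul_sub, Finset.sum_sub_distrib, ← Finset.sum_smul, ha1, ha]
        module
      rw [h1, h2, smul_smul, inv_mul_cancel₀ hτ.ne', one_smul]
      abel
  · rintro ⟨lam, hlam, rfl⟩
    have hS : 0 ≤ ∑ w ∈ V, lam w := Finset.sum_nonneg fun w _ => hlam w
    set S := ∑ w ∈ V, lam w with hSdef
    have hS1 : 0 < S + 1 := by linarith
    refine ⟨(S + 1)⁻¹, inv_pos.2 hS1, ?_⟩
    have key : x + (S + 1)⁻¹ • (x + ∑ w ∈ V, lam w • (w - x) - x) =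
        (S + 1)⁻¹ • x + ∑ w ∈ V, ((S + 1)⁻¹ * lam w) • w := by
      have h1 : ∑ w ∈ V, ((S + 1)⁻¹ * lam w) • w = (S + 1)⁻¹ • ∑ w ∈ V, lam w • w := by
        simp only [Finset.smul_sum, smul_smul]
      have h2 : ∑ w ∈ V, lam w • (w - x) = ∑ w ∈ V, lam w • w - S • x := by
        simp only [smul_sub, Finset.sum_sub_distrib, ← Finset.sum_smul, hSdef]
      rw [h1, h2]
      have : x = ((S + 1)⁻¹ * (S + 1)) • x := by rw [inv_mul_cancel₀ hS1.ne', one_smul]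
      nth_rewrite 1 [this]
      module
    rw [key, Finset.mem_convexHull']
    refine ⟨fun w => (S + 1)⁻¹ * lam w + if w = x then (S + 1)⁻¹ else 0, fun w _ => ?_, ?_, ?_⟩
    · have := hlam w
      have := inv_pos.2 hS1
      dsimp only
      split_ifs <;> positivity
    · rw [Finset.sum_add_distrib, ← Finset.mul_sum, ← hSdef, Finset.sum_ite_eq' V x, if_pos hx]
      field_simp
    · simp only [add_smul, Finset.sum_add_distrib, ite_smul, zero_smul, Finset.sum_ite_eq', hx,
        if_true]
      rw [add_comm]

/-- An integer point close enough to the tangent cone of a rational polytope at a vertex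
lies in that cone. -/
theorem eventually_toR_mem_vertexCone (d : ℕ) (V : Finset (Fin d → ℝ))
    (hrat : ∀ x ∈ V, ∀ i, ∃ q : ℚ, x i = (q : ℝ)) {x : Fin d → ℝ} (hx : x ∈ V) :
    ∀ᶠ δ in 𝓝[>] (0 : ℝ), ∀ (m : Fin d → ℤ) (v : Fin d → ℝ), ‖v‖ < δ →
      toR d m + v ∈ vertexCone d (convexHull ℝ (V : Set (Fin d → ℝ))) x →
      toR d m ∈ vertexCone d (convexHull ℝ (V : Set (Fin d → ℝ))) x := by
  obtain ⟨N, hN, hz⟩ := exists_common_denominator d V hrat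
  have hN' : (0 : ℝ) < N := by exact_mod_cast hN
  choose! z hz using hz
  have hK : IsCompact ((fun μ : (Fin d → ℝ) → ℝ => x + ∑ w ∈ V, μ w • (w - x)) ''
      Set.univ.pi fun _ => Set.Icc (0 : ℝ) N) :=
    (isCompact_univ_pi fun _ => isCompact_Icc).image (by fun_prop)
  filter_upwards [eventually_toR_mem_of_add_mem d hK] with δ hδ m v hv hmv
  rw [mem_vertexCone_convexHull_iff d V hx] at hmv ⊢
  obtain ⟨lam, hlam, hsum⟩ := hmv
  set k : (Fin d → ℝ) → ℕ := fun w => ⌊lam w / N⌋₊ with hk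
  have hshift : toR d (m - ∑ w ∈ V, (k w : ℤ) • (z w - z x)) =
      toR d m - ∑ w ∈ V, (k w * N : ℝ) • (w - x) := by
    have hzz : ∀ w ∈ V, ∀ i, ((z w i : ℤ) : ℝ) = N * w i := fun w hw i => by
      simpa [toR] using congrFun (hz w hw) i
    funext i
    simp only [toR, Pi.sub_apply, Finset.sum_apply, Pi.smul_apply, smul_eq_mul, Int.cast_sub,
      Int.cast_sum, Int.cast_mul, Int.cast_natCast]
    congr 1
    refine Finset.sum_congr rfl fun w hw => ?_
    rw [hzz w hw, hzz x hx]
    ring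
  have hmem : toR d (m - ∑ w ∈ V, (k w : ℤ) • (z w - z x)) ∈
      ((fun μ : (Fin d → ℝ) → ℝ => x + ∑ w ∈ V, μ w • (w - x)) ''
        Set.univ.pi fun _ => Set.Icc (0 : ℝ) N) := by
    refine hδ _ v hv ⟨fun w => lam w - k w * N, fun w _ => ?_, ?_⟩
    · have h1 := Nat.floor_le (div_nonneg (hlam w) hN'.le)
      have h2 := (Nat.lt_floor_add_one (lam w / N)).le
      rw [le_div_iff₀ hN'] at h1
      rw [div_le_iff₀ hN'] at h2
      constructor
      · simpa [hk] using h1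
      · simp only [hk]
        linarith
    · rw [hshift]
      simp only [sub_smul _ _ (_ - x), Finset.sum_sub_distrib]
      rw [sub_add_eq_add_sub, hsum]
      abel
  obtain ⟨μ, hμ, hμm⟩ := hmem
  refine ⟨fun w => μ w + k w * N, fun w => ?_, ?_⟩
  · have := (hμ w trivial).1
    positivity
  · rw [hshift] at hμm
    simp only [add_smul, Finset.sum_add_distrib]
    rw [← add_assoc]
    exact (eq_add_of_sub_eq' hμm.symm).trans (add_comm _ _)

/-- Moving a point towards a point `c` of the convex set `P` stays in the tangent cone. -/
theorem add_smul_sub_mem_vertexCone (d : ℕ) {P : Set (Fin d → ℝ)} (hP : Convex ℝ P)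
    {x y c : Fin d → ℝ} (hc : c ∈ P) {ε : ℝ} (hε : 0 ≤ ε) (hy : y ∈ vertexCone d P x) :
    y + ε • (c - x) ∈ vertexCone d P x := by
  obtain ⟨τ, hτ, h⟩ := hy
  have h0 : 0 < 1 + ε * τ := by positivity
  refine ⟨τ / (1 + ε * τ), by positivity, ?_⟩
  have := hP h hc (a := 1 / (1 + ε * τ)) (b := ε * τ / (1 + ε * τ)) (by positivity)
    (by positivity) (by field_simp)
  convert this using 1
  funext i
  simp only [Pi.add_apply, Pi.sub_apply, Pi.smul_apply, smul_eq_mul]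
  field_simp
  ring

/-- A point of a full-dimensional simplex lying on no facet hyperplane is interior. -/
theorem mem_interior_simplex (d : ℕ) {p : Fin (d + 1) → Fin d → ℝ} (hp : AffineIndependent ℝ p)
    {y : Fin d → ℝ} (hy : y ∈ convexHull ℝ (Set.range p))
    (hfacet : ∀ j, y ∉ affineSpan ℝ (p '' {i | i ≠ j})) :
    y ∈ interior (convexHull ℝ (Set.range p)) := by
  have htop : affineSpan ℝ (Set.range p) = ⊤ :=
    hp.affineSpan_eq_top_iff_card_eq_finrank_add_one.2 (by simp)
  let b : AffineBasis (Fin (d + 1)) ℝ (Fin d → ℝ) := ⟨p, hp, htop⟩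
  have hb : Set.range b = Set.range p := rfl
  rw [← hb, b.convexHull_eq_nonneg_coord] at hy
  rw [← hb, b.interior_convexHull]
  intro j
  refine lt_of_le_of_ne (hy j) fun h0 => hfacet j ?_
  rw [← b.affineCombination_coord_eq_self y]
  refine affineCombination_mem_affineSpan_image (b.sum_coord_apply_eq_one y) (fun i _ hi => ?_) _
  have : i = j := by simpa using hi
  rw [this, ← h0]

/-- For almost every centre, a homothety moves a proper affine subspace off all integer
points. -/
theorem ae_toR_notMem_homothety (d : ℕ) {A : AffineSubspace ℝ (Fin d → ℝ)} (hA : A ≠ ⊤) {r : ℝ}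
    (hr : r ≠ 0) :
    ∀ᵐ c : Fin d → ℝ, ∀ m : Fin d → ℤ, AffineMap.homothety (toR d m) r c ∉ A := by
  rw [MeasureTheory.ae_all_iff]
  intro m
  have hB : A.comap (AffineMap.homothety (toR d m) r) ≠ ⊤ := by
    intro h
    refine hA (top_unique fun y _ => ?_)
    have : AffineMap.homothety (toR d m) r⁻¹ y ∈
        A.comap (AffineMap.homothety (toR d m) r) := h ▸ AffineSubspace.mem_top _ _ _
    rw [AffineSubspace.mem_comap, ← AffineMap.homothety_mul_apply, mul_inv_cancel₀ hr] at this
    simpa using this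
  exact MeasureTheory.measure_eq_zero_iff_ae_notMem.1
    (MeasureTheory.Measure.addHaar_affineSubspace MeasureTheory.volume _ hB)

/-- **Irrational decomposition of a polytope.** Let `P` be a
full-dimensional polytope with rational vertex set `V`, decomposed into `d`-simplices
`P_t = conv(p t 0, …, p t d)` with vertices among `V` and pairwise disjoint interiors.
Then there are `ε > 0` and `s ∈ ℝ^d` such that for `P' = s + (1+ε)P` and
`P'_t = s + (1+ε)P_t`: `P' ∩ ℤ^d = P ∩ ℤ^d`; no hyperplane through a facet of some `P'_t`
contains an integer point; the vertex tangent cones of `P'` and `P` at corresponding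
vertices contain the same integer points; and `P' ∩ ℤ^d` is the disjoint union of the
`P'_t ∩ ℤ^d`. -/
theorem statement13 (d l : ℕ) (V : Finset (Fin d → ℝ))
    (hrat : ∀ x ∈ V, ∀ i, ∃ q : ℚ, x i = (q : ℝ))
    (hvert : (V : Set (Fin d → ℝ)) =
      Set.extremePoints ℝ (convexHull ℝ (V : Set (Fin d → ℝ))))
    (hfull : (interior (convexHull ℝ (V : Set (Fin d → ℝ)))).Nonempty)
    (p : Fin l → Fin (d + 1) → Fin d → ℝ)
    (haff : ∀ t, AffineIndependent ℝ (p t))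
    (hpV : ∀ t i, p t i ∈ V)
    (hcover : convexHull ℝ (V : Set (Fin d → ℝ)) = ⋃ t, convexHull ℝ (Set.range (p t)))
    (hdisj : ∀ t t', t ≠ t' → Disjoint (interior (convexHull ℝ (Set.range (p t))))
      (interior (convexHull ℝ (Set.range (p t'))))) :
    ∃ (ε : ℝ) (s : Fin d → ℝ), 0 < ε ∧
      (∀ m : Fin d → ℤ,
        toR d m ∈ (fun y => s + (1 + ε) • y) '' convexHull ℝ (V : Set (Fin d → ℝ)) ↔
          toR d m ∈ convexHull ℝ (V : Set (Fin d → ℝ))) ∧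
      (∀ (t : Fin l) (j : Fin (d + 1)) (m : Fin d → ℤ),
        toR d m ∉ (affineSpan ℝ ((fun i => s + (1 + ε) • p t i) '' {i | i ≠ j}) :
          Set (Fin d → ℝ))) ∧
      (∀ x ∈ V, ∀ m : Fin d → ℤ,
        (toR d m ∈ {y | ∃ τ : ℝ, 0 < τ ∧ (s + (1 + ε) • x) + τ • (y - (s + (1 + ε) • x)) ∈
            (fun y => s + (1 + ε) • y) '' convexHull ℝ (V : Set (Fin d → ℝ))}) ↔
        (toR d m ∈ {y | ∃ τ : ℝ, 0 < τ ∧ x + τ • (y - x) ∈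
            convexHull ℝ (V : Set (Fin d → ℝ))})) ∧
      (∀ m : Fin d → ℤ,
        toR d m ∈ (fun y => s + (1 + ε) • y) '' convexHull ℝ (V : Set (Fin d → ℝ)) ↔
          ∃! t : Fin l,
            toR d m ∈ (fun y => s + (1 + ε) • y) '' convexHull ℝ (Set.range (p t))) := by
  have hPconv : Convex ℝ (convexHull ℝ (V : Set (Fin d → ℝ))) := convex_convexHull ℝ _
  have hPcomp : IsCompact (convexHull ℝ (V : Set (Fin d → ℝ))) :=
    V.finite_toSet.isCompact_convexHull ℝ
  have hVP : ∀ x ∈ V, x ∈ convexHull ℝ (V : Set (Fin d → ℝ)) := fun x hx =>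
    subset_convexHull ℝ _ hx
  set P := convexHull ℝ (V : Set (Fin d → ℝ)) with hP
  obtain ⟨δ, ⟨hδP, hδV⟩, hδ⟩ := (((eventually_toR_mem_of_add_mem d hPcomp).and
    ((Filter.eventually_all_finset V).2 fun x hx =>
      eventually_toR_mem_vertexCone d V hrat hx)).and self_mem_nhdsWithin).exists
  obtain ⟨R, hR0, hR⟩ : ∃ R : ℝ, 0 < R ∧ ∀ x ∈ P, ∀ y ∈ P, ‖x - y‖ < R := by
    refine ⟨Metric.diam P + 1, by positivity, fun x hx y hy => ?_⟩
    have := Metric.dist_le_diam_of_mem hPcomp.isBounded hx hy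
    rw [dist_eq_norm] at this
    linarith
  set ε := δ / R with hεdef
  have hε : 0 < ε := div_pos hδ hR0
  have hε1 : (1 + ε) ≠ 0 := by positivity
  have hsmall : ∀ x ∈ P, ∀ y ∈ P, ‖ε • (x - y)‖ < δ := fun x hx y hy => by
    rw [norm_smul, Real.norm_of_nonneg hε.le]
    calc ε * ‖x - y‖ < ε * R := mul_lt_mul_of_pos_left (hR x hx y hy) hε
      _ = δ := div_mul_cancel₀ _ hR0.ne'
  have hgen : ∀ᵐ c : Fin d → ℝ, ∀ (t : Fin l) (j : Fin (d + 1)) (m : Fin d → ℤ),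
      AffineMap.homothety (toR d m) (ε / (1 + ε)) c ∉ affineSpan ℝ (p t '' {i | i ≠ j}) := by
    rw [MeasureTheory.ae_all_iff]
    intro t
    rw [MeasureTheory.ae_all_iff]
    intro j
    refine ae_toR_notMem_homothety d (fun h => ?_) (div_ne_zero hε.ne' hε1)
    refine (haff t).notMem_affineSpan_sdiff j Set.univ ?_
    have : (Set.univ \ {j} : Set (Fin (d + 1))) = {i | i ≠ j} := by ext; simp
    rw [this, h]
    exact AffineSubspace.mem_top _ _ _
  obtain ⟨c, hcP, hc⟩ : ∃ c ∈ P, ∀ (t : Fin l) (j : Fin (d + 1)) (m : Fin d → ℤ),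
      AffineMap.homothety (toR d m) (ε / (1 + ε)) c ∉ affineSpan ℝ (p t '' {i | i ≠ j}) := by
    obtain ⟨c, hcP, hc⟩ := (MeasureTheory.Measure.dense_of_ae hgen).inter_open_nonempty _
      isOpen_interior hfull
    exact ⟨c, interior_subset hcP, hc⟩
  have himage : ∀ (Q : Set (Fin d → ℝ)) (y : Fin d → ℝ),
      y ∈ (fun y => -(ε • c) + (1 + ε) • y) '' Q ↔
        AffineMap.homothety y (ε / (1 + ε)) c ∈ Q := by
    intro Q y
    have hy : -(ε • c) + (1 + ε) • AffineMap.homothety y (ε / (1 + ε)) c = y := by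
      funext i
      simp only [AffineMap.homothety_apply, vsub_eq_sub, vadd_eq_add, Pi.add_apply,
        Pi.neg_apply, Pi.sub_apply, Pi.smul_apply, smul_eq_mul]
      field_simp
      ring
    constructor
    · rintro ⟨z, hz, hzy⟩
      have : z = AffineMap.homothety y (ε / (1 + ε)) c :=
        smul_right_injective _ hε1 (add_left_cancel (hzy.trans hy.symm))
      exact this ▸ hz
    · exact fun h => ⟨_, h, hy⟩
  refine ⟨ε, -(ε • c), hε, fun m => ⟨?_, fun hm => ?_⟩, fun t j m hm => ?_, fun x hx m => ?_,
    fun m => ⟨fun hm => ?_, ?_⟩⟩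
  · rintro ⟨y, hy, hym⟩
    refine hδP m (ε • (c - y)) (hsmall c hcP y hy) ?_
    have : toR d m + ε • (c - y) = y := by
      rw [← hym]
      module
    rwa [this]
  · rw [himage, AffineMap.homothety_eq_lineMap]
    refine hPconv.lineMap_mem hm hcP ⟨by positivity, ?_⟩
    rw [div_le_one (by positivity)]
    linarith
  · have hmap : (fun i => -(ε • c) + (1 + ε) • p t i) '' {i | i ≠ j} =
        AffineMap.homothety c (1 + ε) '' (p t '' {i | i ≠ j}) := by
      rw [Set.image_image]
      refine Set.image_congr fun i _ => ?_
      rw [AffineMap.homothety_apply, vsub_eq_sub, vadd_eq_add]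
      module
    rw [hmap, ← AffineSubspace.map_span] at hm
    obtain ⟨a, ha, ham⟩ := hm
    refine hc t j m ((himage _ _).1 ⟨a, ha, ?_⟩)
    rw [← ham, AffineMap.homothety_apply, vsub_eq_sub, vadd_eq_add]
    module
  · have hcone : toR d m ∈ {y | ∃ τ : ℝ, 0 < τ ∧ (-(ε • c) + (1 + ε) • x) +
        τ • (y - (-(ε • c) + (1 + ε) • x)) ∈ (fun y => -(ε • c) + (1 + ε) • y) '' P} ↔
        toR d m + ε • (c - x) ∈ vertexCone d P x := by
      have hpt : ∀ τ : ℝ, AffineMap.homothety ((-(ε • c) + (1 + ε) • x) +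
          τ • (toR d m - (-(ε • c) + (1 + ε) • x))) (ε / (1 + ε)) c =
          x + (τ / (1 + ε)) • (toR d m + ε • (c - x) - x) := by
        intro τ
        funext i
        simp only [AffineMap.homothety_apply, vsub_eq_sub, vadd_eq_add, Pi.add_apply,
          Pi.neg_apply, Pi.sub_apply, Pi.smul_apply, smul_eq_mul]
        field_simp
        ring
      simp only [Set.mem_ofPred_eq, himage, hpt, vertexCone]
      constructor
      · rintro ⟨τ, hτ, h⟩
        exact ⟨_, by positivity, h⟩
      · rintro ⟨τ, hτ, h⟩
        refine ⟨τ * (1 + ε), by positivity, ?_⟩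
        rwa [mul_div_cancel_right₀ _ hε1]
    rw [hcone]
    exact ⟨hδV x hx m _ (hsmall c hcP x (hVP x hx)),
      add_smul_sub_mem_vertexCone d hPconv hcP hε.le⟩
  · rw [himage, hcover, Set.mem_iUnion] at hm
    obtain ⟨t, ht⟩ := hm
    refine ⟨t, (himage _ _).2 ht, fun t' ht' => ?_⟩
    by_contra hne
    exact Set.disjoint_left.1 (hdisj t' t hne)
      (mem_interior_simplex d (haff t') ((himage _ _).1 ht') fun j => hc t' j m)
      (mem_interior_simplex d (haff t) ht fun j => hc t j m)
  · rintro ⟨t, ht, -⟩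
    rw [hcover]
    exact Set.image_mono (Set.subset_iUnion _ t) ht

end
end
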